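/- arXiv:math/0611564 — 2 statements merged into one kernel-verified Lean document; each statement's English description precedes it below -/
import Mathlib

section
/- For all ε > 0, σ_x > 0, σ_k > 0 and all Schwartz functions f, g : ℝ → ℂ, the smoothed Wigner transform of the pair (x·f(x), g) satisfies, for every (x,k) ∈ ℝ²: W̃^{σ_x,σ_k;ε}[y·f(y), g](x,k) = x·W̃^{σ_x,σ_k;ε}[f,g](x,k) + (iε/(4π))·∂_k W̃^{σ_x,σ_k;ε}[f,g](x,k) + (ε σ_x²/(4π))·∂_x W̃^{σ_x,σ_k;ε}[f,g](x,k). -/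
open Real MeasureTheory

/-- The scaled Wigner transform `W^ε[f,g](x,k) = ∫ e^{-2πiky} f(x+εy/2) conj(g(x-εy/2)) dy`. -/
noncomputable def wigner (ε : ℝ) (f g : ℝ → ℂ) (x k : ℝ) : ℂ :=
  ∫ y : ℝ, Complex.exp (-(2 * π * Complex.I * k * y)) *
    f (x + ε * y / 2) * (starRingEnd ℂ) (g (x - ε * y / 2))

/-- The smoothed Wigner transform: the Wigner transform convolved with the normalized Gaussian
kernel `(2/(ε σx σk)) exp(-2π(x-x')²/(ε σx²) - 2π(k-k')²/(ε σk²))`. -/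
noncomputable def swt (ε σx σk : ℝ) (f g : ℝ → ℂ) (x k : ℝ) : ℂ :=
  (2 / (ε * σx * σk) : ℂ) *
    ∫ x' : ℝ, ∫ k' : ℝ,
      (Real.exp (-(2 * π * (x - x')^2 / (ε * σx^2)) - 2 * π * (k - k')^2 / (ε * σk^2)) : ℂ) *
        wigner ε f g x' k'

noncomputable def swtKer (a c x k : ℝ) (p : ℝ × ℝ) : ℂ :=
  ((Real.exp (-a * (x - p.1) ^ 2) * Real.exp (-c * p.2 ^ 2) : ℝ) : ℂ) *
    Complex.exp (-(2 * π * Complex.I * k * p.2))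

lemma norm_phase (k y : ℝ) : ‖Complex.exp (-(2 * π * Complex.I * k * y))‖ = 1 := by
  have : (-(2 * π * Complex.I * k * y) : ℂ) = ((-(2 * π * k * y) : ℝ) : ℂ) * Complex.I := by
    push_cast; ring
  rw [this, Complex.norm_exp_ofReal_mul_I]

lemma norm_swtKer (a c x k : ℝ) (p : ℝ × ℝ) :
    ‖swtKer a c x k p‖ = Real.exp (-a * (x - p.1) ^ 2) * Real.exp (-c * p.2 ^ 2) := by
  rw [swtKer, norm_mul, norm_phase, mul_one, Complex.norm_real, Real.norm_of_nonneg (by positivity)]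

lemma continuous_swtKer (a c x k : ℝ) : Continuous (swtKer a c x k) := by
  unfold swtKer
  fun_prop

lemma gauss_int {a : ℝ} (ha : 0 < a) (x : ℝ) :
    Integrable (fun u : ℝ => Real.exp (-a * (x - u) ^ 2)) :=
  (integrable_exp_neg_mul_sq ha).comp_sub_left x

lemma gauss_int_abs {a : ℝ} (ha : 0 < a) (x : ℝ) :
    Integrable (fun u : ℝ => |x - u| * Real.exp (-a * (x - u) ^ 2)) := by
  have := ((integrable_mul_exp_neg_mul_sq ha).norm).comp_sub_left x
  simpa [abs_mul] using this

lemma gauss_int_abs0 {a : ℝ} (ha : 0 < a) :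
    Integrable (fun u : ℝ => |u| * Real.exp (-a * u ^ 2)) := by
  simpa [abs_mul] using (integrable_mul_exp_neg_mul_sq ha).norm

lemma integrable_ker {a c : ℝ} (ha : 0 < a) (hc : 0 < c) (x k : ℝ) (F : ℝ × ℝ → ℂ)
    (hF : Continuous F) (B : ℝ) (hB : ∀ p, ‖F p‖ ≤ B) :
    Integrable (fun p => swtKer a c x k p * F p) := by
  have h0 : Integrable (fun p : ℝ × ℝ => B * (Real.exp (-a * (x - p.1) ^ 2) *
      Real.exp (-c * p.2 ^ 2))) :=
    ((gauss_int ha x).mul_prod (integrable_exp_neg_mul_sq hc)).const_mul B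
  refine h0.mono' ((continuous_swtKer a c x k).mul hF).aestronglyMeasurable (ae_of_all _ ?_)
  intro p
  rw [norm_mul, norm_swtKer, mul_comm]
  exact mul_le_mul_of_nonneg_right (hB p) (by positivity)

lemma deriv_k {a c : ℝ} (ha : 0 < a) (hc : 0 < c) (x k : ℝ) (F : ℝ × ℝ → ℂ)
    (hF : Continuous F) (B : ℝ) (hB : ∀ p, ‖F p‖ ≤ B) :
    Integrable (fun p : ℝ × ℝ => (-(2 * π * Complex.I * p.2)) * (swtKer a c x k p * F p)) ∧
    HasDerivAt (fun k => ∫ p, swtKer a c x k p * F p)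
      (∫ p : ℝ × ℝ, (-(2 * π * Complex.I * p.2)) * (swtKer a c x k p * F p)) k := by
  refine hasDerivAt_integral_of_dominated_loc_of_deriv_le
    (F := fun k p => swtKer a c x k p * F p)
    (F' := fun k p => (-(2 * π * Complex.I * p.2)) * (swtKer a c x k p * F p))
    (bound := fun p => 2 * π * B * (Real.exp (-a * (x - p.1) ^ 2) *
      (|p.2| * Real.exp (-c * p.2 ^ 2)))) (s := Set.univ) Filter.univ_mem ?_ ?_ ?_ ?_ ?_ ?_
  · exact Filter.Eventually.of_forall fun k =>
      ((continuous_swtKer a c x k).mul hF).aestronglyMeasurable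
  · exact integrable_ker ha hc x k F hF B hB
  · have := (continuous_swtKer a c x k)
    exact Continuous.aestronglyMeasurable (by fun_prop)
  · refine ae_of_all _ fun p k _ => ?_
    rw [norm_mul, norm_mul, norm_swtKer]
    have e : ‖(-(2 * π * Complex.I * p.2) : ℂ)‖ = 2 * π * |p.2| := by
      simp [abs_of_pos Real.pi_pos]
    rw [e]
    calc _ = (2 * π * (Real.exp (-a * (x - p.1) ^ 2) *
      (|p.2| * Real.exp (-c * p.2 ^ 2)))) * ‖F p‖ := by ring
      _ ≤ (2 * π * (Real.exp (-a * (x - p.1) ^ 2) *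
      (|p.2| * Real.exp (-c * p.2 ^ 2)))) * B :=
        mul_le_mul_of_nonneg_left (hB p) (by positivity)
      _ = _ := by ring
  · exact ((gauss_int ha x).mul_prod (gauss_int_abs0 hc)).const_mul _
  · refine ae_of_all _ fun p k _ => ?_
    unfold swtKer
    have h1 : HasDerivAt (fun k : ℝ => (-(2 * π * Complex.I * k * p.2) : ℂ))
        (-(2 * π * Complex.I * p.2)) k := by
      have := (((Complex.ofRealCLM.hasDerivAt (x := k)).const_mul
        (2 * π * Complex.I)).mul_const (p.2 : ℂ)).neg
      refine HasDerivAt.congr_deriv this ?_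
      simp
    have h2 := ((h1.cexp).const_mul
      ((Real.exp (-a * (x - p.1) ^ 2) * Real.exp (-c * p.2 ^ 2) : ℝ) : ℂ)).mul_const (F p)
    refine h2.congr_deriv ?_
    ring

lemma gauss_shift {a : ℝ} (ha : 0 < a) {x x0 : ℝ} (h : |x - x0| < 1) (u : ℝ) :
    |x - u| * Real.exp (-a * (x - u) ^ 2) ≤
      Real.exp a * (|x0 - u| * Real.exp (-(a / 2) * (x0 - u) ^ 2)
        + Real.exp (-(a / 2) * (x0 - u) ^ 2)) := by
  have h1 : |x - u| ≤ |x0 - u| + 1 := by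
    have := abs_add_le (x - x0) (x0 - u)
    rw [sub_add_sub_cancel] at this
    linarith
  have h2 : Real.exp (-a * (x - u) ^ 2) ≤ Real.exp a * Real.exp (-(a / 2) * (x0 - u) ^ 2) := by
    rw [← Real.exp_add, Real.exp_le_exp]
    have h3 : (x - x0) ^ 2 ≤ 1 := by
      rw [← sq_abs]; nlinarith [abs_nonneg (x - x0)]
    have h4 : (x0 - u) ^ 2 / 2 ≤ (x - u) ^ 2 + 1 := by
      nlinarith [sq_nonneg ((x - u) + (x - x0))]
    nlinarith
  calc _ ≤ (|x0 - u| + 1) * (Real.exp a * Real.exp (-(a / 2) * (x0 - u) ^ 2)) :=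
        mul_le_mul h1 h2 (by positivity) (by positivity)
    _ = _ := by ring

lemma deriv_x {a c : ℝ} (ha : 0 < a) (hc : 0 < c) (x k : ℝ) (F : ℝ × ℝ → ℂ)
    (hF : Continuous F) (B : ℝ) (hB : ∀ p, ‖F p‖ ≤ B) :
    Integrable (fun p : ℝ × ℝ => (-(2 * a * (x - p.1)) : ℂ) * (swtKer a c x k p * F p)) ∧
    HasDerivAt (fun x => ∫ p, swtKer a c x k p * F p)
      (∫ p : ℝ × ℝ, (-(2 * a * (x - p.1)) : ℂ) * (swtKer a c x k p * F p)) x := by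
  refine hasDerivAt_integral_of_dominated_loc_of_deriv_le
    (F := fun x p => swtKer a c x k p * F p)
    (F' := fun x p => (-(2 * a * (x - p.1)) : ℂ) * (swtKer a c x k p * F p))
    (bound := fun p => 2 * a * B * Real.exp a *
      ((|x - p.1| * Real.exp (-(a / 2) * (x - p.1) ^ 2)
        + Real.exp (-(a / 2) * (x - p.1) ^ 2)) * Real.exp (-c * p.2 ^ 2)))
    (s := Metric.ball x 1) (Metric.ball_mem_nhds x one_pos) ?_ ?_ ?_ ?_ ?_ ?_
  · exact Filter.Eventually.of_forall fun x =>
      ((continuous_swtKer a c x k).mul hF).aestronglyMeasurable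
  · exact integrable_ker ha hc x k F hF B hB
  · have := (continuous_swtKer a c x k)
    exact Continuous.aestronglyMeasurable (by fun_prop)
  · refine ae_of_all _ fun p x' hx' => ?_
    rw [norm_mul, norm_mul, norm_swtKer]
    have e : ‖(-(2 * a * (x' - p.1)) : ℂ)‖ = 2 * a * |x' - p.1| := by
      rw [show (-(2 * a * (x' - p.1)) : ℂ) = ((-(2 * a * (x' - p.1)) : ℝ) : ℂ) by push_cast; rfl,
        Complex.norm_real, norm_neg, norm_mul, norm_mul]
      simp [abs_of_pos ha]
    rw [e]
    have hs := gauss_shift ha (by simpa [Real.dist_eq] using hx' : |x' - x| < 1) p.1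
    calc _ = (|x' - p.1| * Real.exp (-a * (x' - p.1) ^ 2)) * (2 * a * Real.exp (-c * p.2 ^ 2)) *
            ‖F p‖ := by ring
      _ ≤ _ * (2 * a * Real.exp (-c * p.2 ^ 2)) * B :=
        mul_le_mul (mul_le_mul_of_nonneg_right hs (by positivity)) (hB p)
          (norm_nonneg _) (by positivity)
      _ = _ := by ring
  · exact (((gauss_int_abs (half_pos ha) x).add (gauss_int (half_pos ha) x)).mul_prod
      (integrable_exp_neg_mul_sq hc)).const_mul _
  · refine ae_of_all _ fun p x _ => ?_
    unfold swtKer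
    have h0 : HasDerivAt (fun x : ℝ => Real.exp (-a * (x - p.1) ^ 2) * Real.exp (-c * p.2 ^ 2))
        (Real.exp (-a * (x - p.1) ^ 2) * (-(2 * a * (x - p.1))) * Real.exp (-c * p.2 ^ 2)) x := by
      have := ((((hasDerivAt_id x).sub_const p.1).pow 2).const_mul (-a)).exp.mul_const
        (Real.exp (-c * p.2 ^ 2))
      refine HasDerivAt.congr_deriv this ?_
      simp
      ring
    have h2 := ((h0.ofReal_comp).mul_const
      (Complex.exp (-(2 * π * Complex.I * k * p.2)))).mul_const (F p)
    refine h2.congr_deriv ?_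
    push_cast
    ring

lemma gauss_fourier {β : ℝ} (hβ : 0 < β) (k y : ℝ) :
    ∫ k' : ℝ, (Real.exp (-β * (k - k') ^ 2) : ℂ) * Complex.exp (-(2 * π * Complex.I * k' * y)) =
      (π / β : ℂ) ^ (1 / 2 : ℂ) * (Real.exp (-(π ^ 2 / β) * y ^ 2) *
        Complex.exp (-(2 * π * Complex.I * k * y))) := by
  have h := integral_cexp_quadratic (b := -(β : ℂ)) (by simpa using hβ)
    (2 * β * k - 2 * π * Complex.I * y) (-(β * k ^ 2))
  rw [neg_neg] at h
  have hb : (β : ℂ) ≠ 0 := by exact_mod_cast hβ.ne'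
  convert h using 1
  · congr 1
    ext k'
    rw [Complex.ofReal_exp, ← Complex.exp_add]
    congr 1
    push_cast
    ring
  · rw [Complex.ofReal_exp, ← Complex.exp_add]
    congr 2
    push_cast
    field_simp
    ring_nf
    simp only [Complex.I_sq]
    ring

noncomputable def wigF (ε : ℝ) (f g : ℝ → ℂ) (p : ℝ × ℝ) : ℂ :=
  f (p.1 + ε * p.2 / 2) * (starRingEnd ℂ) (g (p.1 - ε * p.2 / 2))

lemma continuous_wigF (ε : ℝ) {f g : ℝ → ℂ} (hf : Continuous f) (hg : Continuous g) :
    Continuous (wigF ε f g) := by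
  unfold wigF
  have := Complex.continuous_conj
  fun_prop

lemma inner_k {ε β : ℝ} (hε : 0 < ε) (hβ : 0 < β) (f : ℝ → ℂ) (hf : Continuous f) (B : ℝ)
    (hB : ∀ y, ‖f y‖ ≤ B) (g : SchwartzMap ℝ ℂ) (x' k : ℝ) :
    ∫ k' : ℝ, (Real.exp (-β * (k - k') ^ 2) : ℂ) * wigner ε f g x' k' =
      (π / β : ℂ) ^ (1 / 2 : ℂ) * ∫ y : ℝ, Real.exp (-(π ^ 2 / β) * y ^ 2) *
        Complex.exp (-(2 * π * Complex.I * k * y)) * wigF ε f g (x', y) := by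
  have hc : Continuous fun y : ℝ => wigF ε f g (x', y) :=
    (continuous_wigF ε hf g.continuous).comp (by fun_prop)
  have hi : Integrable fun y : ℝ => wigF ε f g (x', y) := by
    have h1 : Integrable fun y : ℝ => g (x' - ε / 2 * y) :=
      ((g.integrable (μ := volume)).comp_sub_left x').comp_mul_left' (half_pos hε).ne'
    refine (h1.norm.const_mul B).mono' hc.aestronglyMeasurable (ae_of_all _ fun y => ?_)
    rw [wigF, norm_mul, RCLike.norm_conj]
    rw [show ε * y / 2 = ε / 2 * y by ring]
    exact mul_le_mul_of_nonneg_right (hB _) (norm_nonneg _)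
  have hprod : Integrable (Function.uncurry fun k' y : ℝ =>
      (Real.exp (-β * (k - k') ^ 2) : ℂ) * (Complex.exp (-(2 * π * Complex.I * k' * y)) *
        wigF ε f g (x', y))) (volume.prod volume) := by
    refine ((gauss_int hβ k).mul_prod hi.norm).mono'
      (Continuous.aestronglyMeasurable ?_) (ae_of_all _ fun p => ?_)
    · have : Continuous fun p : ℝ × ℝ => wigF ε f g (x', p.2) := hc.comp continuous_snd
      unfold Function.uncurry
      fun_prop
    · simp only [Function.uncurry]
      rw [norm_mul, norm_mul, norm_phase, one_mul, Complex.norm_real,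
        Real.norm_of_nonneg (by positivity)]
  have e1 : ∀ k' : ℝ, (Real.exp (-β * (k - k') ^ 2) : ℂ) * wigner ε f g x' k' =
      ∫ y : ℝ, (Real.exp (-β * (k - k') ^ 2) : ℂ) * (Complex.exp (-(2 * π * Complex.I * k' * y)) *
        wigF ε f g (x', y)) := by
    intro k'
    rw [integral_const_mul]
    simp only [wigner, wigF, mul_assoc]
  simp_rw [e1]
  rw [integral_integral_swap hprod, ← integral_const_mul]
  congr 1
  ext y
  simp_rw [← mul_assoc]
  rw [integral_mul_const, gauss_fourier hβ]
  ring

lemma swt_eq {ε σx σk : ℝ} (hε : 0 < ε) (hσx : 0 < σx) (hσk : 0 < σk) (f : ℝ → ℂ)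
    (hf : Continuous f) (B : ℝ) (hB : ∀ y, ‖f y‖ ≤ B) (g : SchwartzMap ℝ ℂ) (x k : ℝ) (D : ℝ)
    (hD : ∀ p, ‖wigF ε f g p‖ ≤ D) :
    swt ε σx σk f g x k = (2 / (ε * σx * σk) : ℂ) *
      (π / (2 * π / (ε * σk ^ 2) : ℝ) : ℂ) ^ (1 / 2 : ℂ) *
      ∫ p, swtKer (2 * π / (ε * σx ^ 2)) (π ^ 2 / (2 * π / (ε * σk ^ 2))) x k p *
        wigF ε f g p := by
  set a := 2 * π / (ε * σx ^ 2) with ha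
  set β := 2 * π / (ε * σk ^ 2) with hb
  have ha0 : 0 < a := by positivity
  have hb0 : 0 < β := by positivity
  have hi := integrable_ker ha0 (c := π ^ 2 / β) (by positivity) x k (wigF ε f g)
    (continuous_wigF ε hf g.continuous) D hD
  rw [Measure.volume_eq_prod] at hi ⊢
  rw [integral_prod _ hi, swt, mul_assoc (2 / (ε * σx * σk) : ℂ)]
  congr 1
  rw [← integral_const_mul]
  congr 1
  ext x'
  have e : ∀ k' : ℝ, (Real.exp (-(2 * π * (x - x')^2 / (ε * σx^2))
      - 2 * π * (k - k')^2 / (ε * σk^2)) : ℂ) * wigner ε f g x' k' =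
      (Real.exp (-a * (x - x') ^ 2) : ℂ) *
        ((Real.exp (-β * (k - k') ^ 2) : ℂ) * wigner ε f g x' k') := by
    intro k'
    rw [← mul_assoc, ← Complex.ofReal_mul, ← Real.exp_add, ha, hb]
    congr 3
    ring
  simp_rw [e]
  rw [integral_const_mul, inner_k hε hb0 f hf B hB, mul_left_comm, ← integral_const_mul]
  congr 1
  refine integral_congr_ae (ae_of_all _ fun y => ?_)
  simp only [swtKer]
  push_cast
  ring

/-- Identity (3a): the SWT of `(y·f(y), g)` in terms of the SWT of `(f,g)` and its
phase-space derivatives. -/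
theorem swt_mul_left (ε σx σk : ℝ) (hε : 0 < ε) (hσx : 0 < σx) (hσk : 0 < σk)
    (f g : SchwartzMap ℝ ℂ) (x k : ℝ) :
    swt ε σx σk (fun y => (y : ℂ) * f y) (⇑g) x k =
      (x : ℂ) * swt ε σx σk (⇑f) (⇑g) x k
      + Complex.I * ε / (4 * π) * deriv (fun k' => swt ε σx σk (⇑f) (⇑g) x k') k
      + (ε * σx ^ 2 / (4 * π) : ℂ) * deriv (fun x' => swt ε σx σk (⇑f) (⇑g) x' k) x := by
  obtain ⟨Bf, hBf0, hBf⟩ := f.decay 0 0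
  obtain ⟨B1, hB10, hB1⟩ := f.decay 1 0
  obtain ⟨Bg, hBg0, hBg⟩ := g.decay 0 0
  simp only [pow_zero, one_mul, norm_iteratedFDeriv_zero, pow_one] at hBf hB1 hBg
  have hB1' : ∀ y : ℝ, ‖(y : ℂ) * f y‖ ≤ B1 := fun y => by
    rw [norm_mul, Complex.norm_real]; exact hB1 y
  have hD : ∀ p, ‖wigF ε f g p‖ ≤ Bf * Bg := fun p => by
    rw [wigF, norm_mul, RCLike.norm_conj]
    exact mul_le_mul (hBf _) (hBg _) (norm_nonneg _) hBf0.le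
  have hD1 : ∀ p, ‖wigF ε (fun y => (y : ℂ) * f y) g p‖ ≤ B1 * Bg := fun p => by
    rw [wigF, norm_mul, RCLike.norm_conj]
    exact mul_le_mul (hB1' _) (hBg _) (norm_nonneg _) hB10.le
  have hc1 : Continuous (fun y : ℝ => (y : ℂ) * f y) :=
    Complex.continuous_ofReal.mul f.continuous
  rw [swt_eq hε hσx hσk _ hc1 B1 hB1' g x k _ hD1]
  simp_rw [fun x k => swt_eq hε hσx hσk f f.continuous Bf hBf g x k _ hD]
  have hcF := continuous_wigF ε f.continuous g.continuous
  have ha0 : 0 < 2 * π / (ε * σx ^ 2) := by positivity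
  have hc0 : 0 < π ^ 2 / (2 * π / (ε * σk ^ 2)) := by positivity
  have haC : ((2 * π / (ε * σx ^ 2) : ℝ) : ℂ) = 2 * π / (ε * σx ^ 2) := by push_cast; rfl
  generalize (2 / (ε * σx * σk) : ℂ) *
      (π / (2 * π / (ε * σk ^ 2) : ℝ) : ℂ) ^ (1 / 2 : ℂ) = C
  generalize π ^ 2 / (2 * π / (ε * σk ^ 2)) = c at *
  generalize 2 * π / (ε * σx ^ 2) = a at *
  obtain ⟨ik, dk⟩ := deriv_k ha0 hc0 x k _ hcF _ hD
  obtain ⟨ix, dx⟩ := deriv_x ha0 hc0 x k _ hcF _ hD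
  have i0 := integrable_ker ha0 hc0 x k _ hcF _ hD
  rw [(dk.const_mul C).deriv, (dx.const_mul C).deriv]
  have key : ∫ p, swtKer a c x k p * wigF ε (fun y => (y : ℂ) * f y) g p =
      x * (∫ p, swtKer a c x k p * wigF ε f g p) +
      Complex.I * ε / (4 * π) *
        (∫ p : ℝ × ℝ, (-(2 * π * Complex.I * p.2)) * (swtKer a c x k p * wigF ε f g p)) +
      (ε * σx ^ 2 / (4 * π) : ℂ) *
        (∫ p : ℝ × ℝ, (-(2 * a * (x - p.1)) : ℂ) * (swtKer a c x k p * wigF ε f g p)) := by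
    have i1 : Integrable (fun p : ℝ × ℝ => (x : ℂ) * (swtKer a c x k p * wigF ε f g p) +
        Complex.I * ε / (4 * π) *
          ((-(2 * π * Complex.I * p.2)) * (swtKer a c x k p * wigF ε f g p))) :=
      (i0.const_mul _).add (ik.const_mul _)
    rw [← integral_const_mul, ← integral_const_mul, ← integral_const_mul,
      ← integral_add (i0.const_mul _) (ik.const_mul _),
      ← integral_add i1 (ix.const_mul _)]
    congr 1
    ext p
    have hπ : (π : ℂ) ≠ 0 := by exact_mod_cast Real.pi_ne_zero
    have hε' : (ε : ℂ) ≠ 0 := by exact_mod_cast hε.ne'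
    have hσ' : (σx : ℂ) ≠ 0 := by exact_mod_cast hσx.ne'
    have hid : ((p.1 + ε * p.2 / 2 : ℝ) : ℂ) = x + Complex.I * ε / (4 * π) *
        (-(2 * π * Complex.I * p.2)) + (ε * σx ^ 2 / (4 * π) : ℂ) * (-(2 * a * (x - p.1))) := by
      rw [haC]
      push_cast
      field_simp
      ring_nf
      simp only [Complex.I_sq]
      ring
    simp only [wigF]
    rw [hid]
    ring
  rw [key]
  ring
end

section
/- Exact closed equation for the smoothed Wigner transform under a quadratic potential: let ε > 0, σ_x > 0, σ_k > 0, let V(x) = a x² + b x + c with a, b, c ∈ ℝ, and let u : ℝ × ℝ → ℂ be smooth, Schwartz in x for each t with all Schwartz seminorms (in x, of u and of ∂_t u) locally bounded in t, satisfying ε ∂_t u(x,t) − i(ε²/2) ∂²_x u(x,t) + i V(x) u(x,t) = 0 for all (x,t). Then W̃(x,k,t) := W̃^{σ_x,σ_k;ε}[u(·,t)](x,k) satisfies exactly (with no error term) the equation ∂_t W̃ + 2πk ∂_x W̃ − (V'(x)/(2π)) ∂_k W̃ + ε·(σ_k²/2 − V''(x)·σ_x²/(8π²))·∂²_{xk}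 W̃ = 0 for all (x,k,t), where V'(x) = 2ax + b and V''(x) = 2a. -/
open Real MeasureTheory

/-- Gaussian kernel obtained after integrating out `k'` and changing variables. -/
noncomputable def kerK (A B ε x k p q : ℝ) : ℂ :=
  Complex.exp (((-A * (x - (p + q) / 2) ^ 2 - B * ((p - q) / ε) ^ 2 : ℝ) : ℂ)
    - 2 * π * Complex.I * k * (((p - q) / ε : ℝ) : ℂ))

/-- quadratic decay: continuous and bounded by a multiple of `(1+p²)⁻²`. -/
def Dec (C : ℝ) (f : ℝ → ℂ) : Prop := Continuous f ∧ ∀ p, ‖f p‖ ≤ C * ((1 + p ^ 2)⁻¹) ^ 2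

lemma Dec.conj {C : ℝ} {f : ℝ → ℂ} (h : Dec C f) : Dec C (fun x => (starRingEnd ℂ) (f x)) := by
  refine ⟨Complex.continuous_conj.comp h.1, fun p => ?_⟩
  simpa using h.2 p

lemma Dec.nonneg {C : ℝ} {f : ℝ → ℂ} (h : Dec C f) : 0 ≤ C := by
  have := h.2 0
  simp at this
  exact (norm_nonneg _).trans this

lemma kerK_norm {A B : ℝ} (hA : 0 ≤ A) (hB : 0 ≤ B) (ε x k p q : ℝ) :
    ‖kerK A B ε x k p q‖ ≤ 1 := by
  unfold kerK
  rw [Complex.norm_exp]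
  have : (((-A * (x - (p + q) / 2) ^ 2 - B * ((p - q) / ε) ^ 2 : ℝ) : ℂ)
    - 2 * π * Complex.I * k * (((p - q) / ε : ℝ) : ℂ)).re
      = -A * (x - (p + q) / 2) ^ 2 - B * ((p - q) / ε) ^ 2 := by
    have h : (2 * π * Complex.I * k * (((p - q) / ε : ℝ) : ℂ)) =
        ((2 * π * k * ((p - q) / ε) : ℝ) : ℂ) * Complex.I := by push_cast; ring
    rw [h, Complex.sub_re, Complex.ofReal_re, Complex.re_ofReal_mul, Complex.I_re]
    ring
  rw [this, Real.exp_le_one_iff]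
  have h1 := mul_nonneg hA (sq_nonneg (x - (p + q) / 2))
  have h2 := mul_nonneg hB (sq_nonneg ((p - q) / ε))
  linarith

lemma kerK_cont (A B ε x k : ℝ) : Continuous (fun z : ℝ × ℝ => kerK A B ε x k z.1 z.2) := by
  unfold kerK
  fun_prop

lemma ww_integrable (M : ℝ) :
    Integrable (fun z : ℝ × ℝ => M * ((1 + z.1 ^ 2)⁻¹ * (1 + z.2 ^ 2)⁻¹)) := by
  exact (integrable_inv_one_add_sq.mul_prod integrable_inv_one_add_sq).const_mul M

lemma rho_sq (p q : ℝ) : (1 + |p| + |q|) ^ 2 ≤ 3 * ((1 + p ^ 2) * (1 + q ^ 2)) := by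
  have hp := sq_abs p
  have hq := sq_abs q
  rw [← hp, ← hq]
  nlinarith [sq_nonneg (|p| - 1), sq_nonneg (|q| - 1), sq_nonneg (|p| - |q|),
    sq_nonneg (|p| * |q|)]

lemma bound_of {C D M : ℝ} {f g : ℝ → ℂ} (hf : Dec C f) (hg : Dec D g) {m : ℂ} {p q : ℝ}
    (hm : ‖m‖ ≤ M * (1 + |p| + |q|) ^ 2) :
    ‖m * (f p * g q)‖ ≤ (3 * M * C * D) * ((1 + p ^ 2)⁻¹ * (1 + q ^ 2)⁻¹) := by
  have hM : 0 ≤ M := by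
    have := (norm_nonneg m).trans hm
    by_contra h
    have h2 : 0 < (1 + |p| + |q|) ^ 2 := by positivity
    nlinarith [not_le.mp h]
  have hC := hf.nonneg
  have hD := hg.nonneg
  rw [norm_mul, norm_mul]
  calc ‖m‖ * (‖f p‖ * ‖g q‖)
      ≤ (M * (3 * ((1 + p ^ 2) * (1 + q ^ 2)))) *
        ((C * ((1 + p ^ 2)⁻¹) ^ 2) * (D * ((1 + q ^ 2)⁻¹) ^ 2)) := by
        have := hf.2 p
        have := hg.2 q
        have h3 : ‖m‖ ≤ M * (3 * ((1 + p ^ 2) * (1 + q ^ 2))) :=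
          hm.trans (mul_le_mul_of_nonneg_left (rho_sq p q) hM)
        gcongr
    _ = _ := by
        have h1 : (1 + p ^ 2) ≠ 0 := by positivity
        have h2 : (1 + q ^ 2) ≠ 0 := by positivity
        field_simp

lemma int_of {M : ℝ} {F : ℝ × ℝ → ℂ} (hc : Continuous F)
    (hb : ∀ z, ‖F z‖ ≤ M * ((1 + z.1 ^ 2)⁻¹ * (1 + z.2 ^ 2)⁻¹)) : Integrable F :=
  (ww_integrable M).mono' hc.aestronglyMeasurable (Filter.Eventually.of_forall hb)

lemma deriv_param {F F' : ℝ → ℝ × ℝ → ℂ} {x₀ M : ℝ}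
    (hF : ∀ x, Continuous (F x)) (hF' : Continuous (F' x₀))
    (hb : ∀ z, ‖F x₀ z‖ ≤ M * ((1 + z.1 ^ 2)⁻¹ * (1 + z.2 ^ 2)⁻¹))
    {M' : ℝ}
    (hb' : ∀ x ∈ Metric.ball x₀ 1, ∀ z,
      ‖F' x z‖ ≤ M' * ((1 + z.1 ^ 2)⁻¹ * (1 + z.2 ^ 2)⁻¹))
    (hd : ∀ x z, HasDerivAt (fun x => F x z) (F' x z) x) :
    HasDerivAt (fun x => ∫ z, F x z) (∫ z, F' x₀ z) x₀ := by
  refine (hasDerivAt_integral_of_dominated_loc_of_deriv_le (Metric.ball_mem_nhds x₀ one_pos)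
    (Filter.Eventually.of_forall fun x => (hF x).aestronglyMeasurable) (int_of (hF x₀) hb)
    hF'.aestronglyMeasurable
    (Filter.Eventually.of_forall fun z x hx => hb' x hx z) (ww_integrable M')
    (Filter.Eventually.of_forall fun z x _ => hd x z)).2

/-- one-dimensional double integration by parts -/
lemma ibp2 {E E' E'' g g' g'' : ℝ → ℂ} {M C C' C'' : ℝ}
    (hE : Continuous E) (hE' : Continuous E') (hE'' : Continuous E'')
    (bE : ∀ p, ‖E p‖ ≤ M * (1 + p ^ 2)) (bE' : ∀ p, ‖E' p‖ ≤ M * (1 + p ^ 2))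
    (bE'' : ∀ p, ‖E'' p‖ ≤ M * (1 + p ^ 2))
    (dE : ∀ p, HasDerivAt E (E' p) p) (dE' : ∀ p, HasDerivAt E' (E'' p) p)
    (hg : Dec C g) (hg' : Dec C' g') (hg'' : Dec C'' g'')
    (dg : ∀ p, HasDerivAt g (g' p) p) (dg' : ∀ p, HasDerivAt g' (g'' p) p) :
    ∫ p, E p * g'' p = ∫ p, E'' p * g p := by
  have key : ∀ {e f : ℝ → ℂ} {D : ℝ}, Continuous e → (∀ p, ‖e p‖ ≤ M * (1 + p ^ 2)) →
      Dec D f → Integrable (e * f) := by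
    intro e f D he hb hf
    refine ((integrable_inv_one_add_sq).const_mul (M * D)).mono'
      (he.mul hf.1).aestronglyMeasurable (Filter.Eventually.of_forall fun p => ?_)
    simp only [Pi.mul_apply, norm_mul]
    have h1 : (1 + p ^ 2) ≠ 0 := by positivity
    calc ‖e p‖ * ‖f p‖ ≤ (M * (1 + p ^ 2)) * (D * ((1 + p ^ 2)⁻¹) ^ 2) :=
          mul_le_mul (hb p) (hf.2 p) (norm_nonneg _) ((norm_nonneg _).trans (hb p))
      _ = _ := by field_simp
  rw [integral_mul_deriv_eq_deriv_mul_of_integrable (fun x _ => dE x) (fun x _ => dg' x)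
    (key hE bE hg'') (key hE' bE' hg') (key hE bE hg'),
    integral_mul_deriv_eq_deriv_mul_of_integrable (fun x _ => dE' x) (fun x _ => dg x)
    (key hE' bE' hg') (key hE'' bE'' hg) (key hE' bE' hg), neg_neg]

lemma change_vars {ε M : ℝ} (hε : 0 < ε) {H : ℝ × ℝ → ℂ} (hc : Continuous H)
    (hb : ∀ z, ‖H z‖ ≤ M * (((1 + z.1 ^ 2)⁻¹) ^ 2 * ((1 + z.2 ^ 2)⁻¹) ^ 2)) :
    ∫ x : ℝ, ∫ y : ℝ, H (x + ε * y / 2, x - ε * y / 2) = (ε⁻¹ : ℝ) • ∫ z, H z := by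
  have hM : 0 ≤ M := by
    have := (norm_nonneg _).trans (hb 0)
    simpa using this
  have hi1 : ∀ x : ℝ, ∫ y : ℝ, H (x + ε * y / 2, x - ε * y / 2)
      = (2 / ε : ℝ) • ∫ p : ℝ, H (p, 2 * x - p) := by
    intro x
    have h1 := Measure.integral_comp_mul_left (fun p => H (x + p, x - p)) (ε / 2)
    have h2 := integral_add_left_eq_self (μ := volume) (fun p => H (p, 2 * x - p)) x
    have h3 : |(ε / 2)⁻¹| = 2 / ε := by rw [abs_of_pos (by positivity)]; simp
    rw [h3] at h1
    rw [← h2]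
    have e1 : ∀ y : ℝ, (x + ε * y / 2, x - ε * y / 2) = (x + ε / 2 * y, x - ε / 2 * y) := by
      intro y; ext <;> simp <;> ring
    have e2 : ∀ y : ℝ, 2 * x - (x + y) = x - y := by intro y; ring
    simp_rw [e1, e2]
    exact h1
  simp_rw [hi1]
  rw [integral_smul, integral_integral_swap]
  · have hi2 : ∀ p : ℝ, ∫ x : ℝ, H (p, 2 * x - p) = (1 / 2 : ℝ) • ∫ q : ℝ, H (p, q) := by
      intro p
      have h1 := Measure.integral_comp_mul_left (fun q => H (p, q - p)) 2
      have h2 := integral_sub_right_eq_self (μ := volume) (fun q => H (p, q)) p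
      rw [h1, h2]
      norm_num
    simp_rw [hi2]
    rw [integral_smul, smul_smul]
    have : Integrable H (volume.prod volume) := by
      refine int_of (M := M) hc fun z => (hb z).trans ?_
      have a1 : (1 + z.1 ^ 2)⁻¹ ≤ 1 := inv_le_one_of_one_le₀ (by nlinarith [sq_nonneg z.1])
      have a2 : (1 + z.2 ^ 2)⁻¹ ≤ 1 := inv_le_one_of_one_le₀ (by nlinarith [sq_nonneg z.2])
      have b1 : 0 ≤ (1 + z.1 ^ 2)⁻¹ := by positivity
      have b2 : 0 ≤ (1 + z.2 ^ 2)⁻¹ := by positivity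
      gcongr
      · nlinarith
      · nlinarith
    rw [Measure.volume_eq_prod, integral_prod _ this]
    congr 1
    field_simp
  · refine int_of (M := M) (by unfold Function.uncurry; fun_prop) fun z => ?_
    obtain ⟨x, p⟩ := z
    refine (hb (p, 2 * x - p)).trans ?_
    simp only
    apply mul_le_mul_of_nonneg_left _ hM
    rw [← mul_inv]
    have h1 : 0 < (1 + p ^ 2) := by positivity
    have h2 : 0 < (1 + (2 * x - p) ^ 2) := by positivity
    have h3 : 1 + x ^ 2 ≤ (1 + p ^ 2) * (1 + (2 * x - p) ^ 2) := by
      nlinarith [sq_nonneg (p * (2 * x - p)), sq_nonneg (p - (2 * x - p))]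
    have h4 : (1 + p ^ 2) ≤ (1 + p ^ 2) * (1 + (2 * x - p) ^ 2) := by
      nlinarith [sq_nonneg (2 * x - p)]
    rw [← mul_pow, ← mul_inv, inv_pow]
    apply inv_anti₀ (by positivity)
    refine le_of_le_of_eq ?_ (sq _).symm
    exact mul_le_mul h3 h4 h1.le (by positivity)

lemma gauss_ft {Q : ℝ} (hQ : 0 < Q) (k y : ℝ) :
    ∫ k' : ℝ, (Real.exp (-Q * (k - k') ^ 2) : ℂ) * Complex.exp (-(2 * π * Complex.I * k' * y))
      = ((π : ℂ) / Q) ^ (1 / 2 : ℂ) *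
        Complex.exp (((-(π ^ 2 / Q) * y ^ 2 : ℝ) : ℂ) - 2 * π * Complex.I * k * y) := by
  have h := integral_cexp_quadratic (b := -(Q : ℂ)) (by simpa using hQ)
    (2 * Q * k - 2 * π * Complex.I * y) (-Q * k ^ 2)
  have hQ' : (Q : ℂ) ≠ 0 := by exact_mod_cast hQ.ne'
  rw [neg_neg] at h
  have e1 : (-Q * k ^ 2 : ℂ) - (2 * Q * k - 2 * π * Complex.I * y) ^ 2 / (4 * -(Q : ℂ))
      = ((-(π ^ 2 / Q) * y ^ 2 : ℝ) : ℂ) - 2 * π * Complex.I * k * y := by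
    push_cast
    field_simp
    ring_nf
    rw [Complex.I_sq]
    ring
  rw [e1] at h
  rw [← h]
  congr 1
  ext k'
  rw [Complex.ofReal_exp, ← Complex.exp_add]
  congr 1
  push_cast
  ring

lemma inner_eq {Q : ℝ} (hQ : 0 < Q) {Φ : ℝ → ℂ} (hΦ : Integrable Φ) (k : ℝ) :
    ∫ k' : ℝ, (Real.exp (-Q * (k - k') ^ 2) : ℂ) *
      ∫ y : ℝ, Complex.exp (-(2 * π * Complex.I * k' * y)) * Φ y
    = ((π : ℂ) / Q) ^ (1 / 2 : ℂ) * ∫ y : ℝ,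
        Complex.exp (((-(π ^ 2 / Q) * y ^ 2 : ℝ) : ℂ) - 2 * π * Complex.I * k * y) * Φ y := by
  simp_rw [← integral_const_mul]
  rw [integral_integral_swap]
  · congr 1
    ext y
    have := gauss_ft hQ k y
    rw [← mul_assoc, ← this, ← integral_mul_const]
    simp only [mul_assoc]
  · have h1 : Integrable (fun k' : ℝ => (Real.exp (-Q * (k - k') ^ 2) : ℂ)) :=
      ((integrable_exp_neg_mul_sq hQ).comp_sub_left k).ofReal
    have h2 := h1.mul_prod hΦ
    have h3 := h2.bdd_mul (c := 1)
      (f := fun z : ℝ × ℝ => Complex.exp (-(2 * π * Complex.I * z.1 * z.2)))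
      (Continuous.aestronglyMeasurable (by fun_prop)) (Filter.Eventually.of_forall fun z => by
        have : (-(2 * π * Complex.I * z.1 * z.2) : ℂ)
          = ((-(2 * π * z.1 * z.2) : ℝ) : ℂ) * Complex.I := by push_cast; ring
        rw [this, Complex.norm_exp_ofReal_mul_I])
    refine h3.congr (Filter.Eventually.of_forall fun z => ?_)
    simp only [Function.uncurry]
    ring

lemma swt_eq_s16 {ε σx σk : ℝ} (hε : 0 < ε) (hσx : 0 < σx) (hσk : 0 < σk) :
    ∃ c₀ : ℂ, ∀ (C : ℝ) (f : ℝ → ℂ), Dec C f → ∀ x k : ℝ, swt ε σx σk f f x k =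
      c₀ * ∫ z : ℝ × ℝ, kerK (2 * π / (ε * σx ^ 2)) (π * ε * σk ^ 2 / 2) ε x k z.1 z.2 *
        (f z.1 * (starRingEnd ℂ) (f z.2)) := by
  set A := 2 * π / (ε * σx ^ 2) with hA
  set B := π * ε * σk ^ 2 / 2 with hB
  set Q := 2 * π / (ε * σk ^ 2) with hQ
  have hA0 : 0 < A := by positivity
  have hB0 : 0 < B := by positivity
  have hQ0 : 0 < Q := by positivity
  have hBQ : π ^ 2 / Q = B := by rw [hQ, hB]; field_simp
  refine ⟨(2 / (ε * σx * σk) : ℂ) * (((π : ℂ) / Q) ^ (1 / 2 : ℂ) * (ε⁻¹ : ℝ)), ?_⟩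
  intro C f hf x k
  unfold swt
  rw [mul_assoc (2 / ((ε : ℂ) * σx * σk))]
  congr 1
  have hC := hf.nonneg
  have w1 : ∀ p : ℝ, (1 + p ^ 2)⁻¹ ≤ 1 := fun p =>
    inv_le_one_of_one_le₀ (by nlinarith [sq_nonneg p])
  have hΦ : ∀ x' : ℝ, Integrable (fun y : ℝ => f (x' + ε * y / 2) *
      (starRingEnd ℂ) (f (x' - ε * y / 2))) := by
    intro x'
    have hi : Integrable f := by
      refine (integrable_inv_one_add_sq.const_mul C).mono' hf.1.aestronglyMeasurable
        (Filter.Eventually.of_forall fun p => (hf.2 p).trans ?_)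
      have b1 : 0 ≤ (1 + p ^ 2)⁻¹ := by positivity
      gcongr
      nlinarith [w1 p]
    have hi2 : Integrable (fun y : ℝ => f (x' + ε * y / 2)) := by
      have := (hi.comp_add_left x').comp_mul_left' (show ε / 2 ≠ 0 by positivity)
      refine this.congr (Filter.Eventually.of_forall fun y => ?_)
      simp only
      congr 1
      ring
    have hcf := hf.1
    have := hi2.bdd_mul (c := C) (f := fun y : ℝ => (starRingEnd ℂ) (f (x' - ε * y / 2)))
      (Continuous.aestronglyMeasurable (Complex.continuous_conj.comp (by fun_prop)))
      (Filter.Eventually.of_forall fun y => by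
        rw [RCLike.norm_conj]
        refine (hf.2 _).trans ?_
        have b1 : 0 ≤ (1 + (x' - ε * y / 2) ^ 2)⁻¹ := by positivity
        have := w1 (x' - ε * y / 2)
        have h2 : ((1 + (x' - ε * y / 2) ^ 2)⁻¹) ^ 2 ≤ 1 := by nlinarith
        nlinarith)
    refine this.congr (Filter.Eventually.of_forall fun y => ?_)
    simp only
    ring
  have step : ∀ x' : ℝ, ∫ k' : ℝ,
      (Real.exp (-(2 * π * (x - x')^2 / (ε * σx^2)) - 2 * π * (k - k')^2 / (ε * σk^2)) : ℂ) *
        wigner ε f f x' k' = ((π : ℂ) / Q) ^ (1 / 2 : ℂ) * ∫ y : ℝ,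
          (fun z : ℝ × ℝ => kerK A B ε x k z.1 z.2 * (f z.1 * (starRingEnd ℂ) (f z.2)))
            (x' + ε * y / 2, x' - ε * y / 2) := by
    intro x'
    have h1 := inner_eq hQ0 (hΦ x') k
    have h2 : ∀ k' : ℝ,
      (Real.exp (-(2 * π * (x - x')^2 / (ε * σx^2)) - 2 * π * (k - k')^2 / (ε * σk^2)) : ℂ) *
        wigner ε f f x' k' = (Real.exp (-A * (x - x') ^ 2) : ℂ) *
          ((Real.exp (-Q * (k - k') ^ 2) : ℂ) *
      ∫ y : ℝ, Complex.exp (-(2 * π * Complex.I * k' * y)) * (f (x' + ε * y / 2) *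
      (starRingEnd ℂ) (f (x' - ε * y / 2)))) := by
      intro k'
      unfold wigner
      simp only [mul_assoc]
      rw [← mul_assoc ((Real.exp (-A * (x - x') ^ 2) : ℝ) : ℂ), ← Complex.ofReal_mul,
        ← Real.exp_add]
      congr 3
      rw [hA, hQ]
      ring
    simp_rw [h2]
    rw [integral_const_mul, h1, mul_left_comm, ← integral_const_mul]
    congr 2
    ext y
    rw [← mul_assoc]
    congr 1
    unfold kerK
    rw [Complex.ofReal_exp, ← Complex.exp_add, hBQ]
    have e1 : (x' + ε * y / 2 - (x' - ε * y / 2)) / ε = y := by field_simp; ring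
    have e2 : (x' + ε * y / 2 + (x' - ε * y / 2)) / 2 = x' := by ring
    rw [e1, e2]
    congr 1
    push_cast
    ring
  rw [integral_congr_ae (Filter.Eventually.of_forall step)]
  rw [integral_const_mul, change_vars (M := C * C) hε
    (H := fun z : ℝ × ℝ => kerK A B ε x k z.1 z.2 * (f z.1 * (starRingEnd ℂ) (f z.2)))]
  · rw [Complex.real_smul, mul_assoc]
  · have hcf := hf.1
    exact (kerK_cont A B ε x k).mul ((hcf.comp continuous_fst).mul
      (Complex.continuous_conj.comp (hcf.comp continuous_snd)))
  · intro z
    rw [norm_mul, norm_mul, RCLike.norm_conj]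
    have h1 := kerK_norm hA0.le hB0.le ε x k z.1 z.2
    have h2 := hf.2 z.1
    have h3 := hf.2 z.2
    calc _ ≤ 1 * ((C * ((1 + z.1 ^ 2)⁻¹) ^ 2) * (C * ((1 + z.2 ^ 2)⁻¹) ^ 2)) := by gcongr
      _ = _ := by ring

lemma gexp1 (α β γ : ℂ) (s : ℝ) :
    HasDerivAt (fun s : ℝ => Complex.exp (α * s ^ 2 + β * s + γ))
      ((2 * α * s + β) * Complex.exp (α * s ^ 2 + β * s + γ)) s := by
  have h : HasDerivAt (fun s : ℂ => Complex.exp (α * s ^ 2 + β * s + γ))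
      ((2 * α * s + β) * Complex.exp (α * s ^ 2 + β * s + γ)) (s : ℂ) := by
    have h1 : HasDerivAt (fun s : ℂ => α * s ^ 2 + β * s + γ) (2 * α * s + β) (s : ℂ) := by
      have := (((hasDerivAt_pow 2 (s : ℂ)).const_mul α).add
        ((hasDerivAt_id (s : ℂ)).const_mul β)).add_const γ
      refine this.congr_deriv ?_
      simp
      ring
    refine h1.cexp.congr_deriv ?_
    ring
  exact h.comp_ofReal

lemma gexp2 (α β γ : ℂ) (s : ℝ) :
    HasDerivAt (fun s : ℝ => (2 * α * s + β) * Complex.exp (α * s ^ 2 + β * s + γ))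
      (((2 * α * s + β) ^ 2 + 2 * α) * Complex.exp (α * s ^ 2 + β * s + γ)) s := by
  have h1 : HasDerivAt (fun s : ℝ => 2 * α * (s : ℂ) + β) (2 * α) s := by
    have : HasDerivAt (fun s : ℂ => 2 * α * s + β) (2 * α) (s : ℂ) := by
      simpa using ((hasDerivAt_id (s : ℂ)).const_mul (2 * α)).add_const β
    exact this.comp_ofReal
  refine (h1.mul (gexp1 α β γ s)).congr_deriv ?_
  ring

/-- logarithmic derivative of the kernel in `p` -/
noncomputable def kLp (A B ε x k p q : ℝ) : ℂ :=
  A * (x - (p + q) / 2) - 2 * B / ε * ((p - q) / ε) - 2 * π * Complex.I * k / ε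

/-- logarithmic derivative of the kernel in `q` -/
noncomputable def kLq (A B ε x k p q : ℝ) : ℂ :=
  A * (x - (p + q) / 2) + 2 * B / ε * ((p - q) / ε) + 2 * π * Complex.I * k / ε

lemma kerK_dx (A B ε x k p q : ℝ) : HasDerivAt (fun x => kerK A B ε x k p q)
    ((-2 * A * (x - (p + q) / 2)) * kerK A B ε x k p q) x := by
  have h := gexp1 (-A) (A * (p + q)) (-A * ((p + q) / 2) ^ 2 - B * ((p - q) / ε) ^ 2
    - 2 * π * Complex.I * k * ((p - q) / ε)) x
  have e : ∀ x : ℝ, kerK A B ε x k p q = Complex.exp (-A * x ^ 2 + (A * (p + q)) * x +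
      (-A * ((p + q) / 2) ^ 2 - B * ((p - q) / ε) ^ 2
    - 2 * π * Complex.I * k * ((p - q) / ε))) := by
    intro x
    unfold kerK
    congr 1
    push_cast
    ring
  simp_rw [e]
  refine h.congr_deriv ?_
  ring

lemma kerK_dk (A B ε x k p q : ℝ) : HasDerivAt (fun k => kerK A B ε x k p q)
    ((-2 * π * Complex.I * ((p - q) / ε)) * kerK A B ε x k p q) k := by
  have h := gexp1 0 (-2 * π * Complex.I * ((p - q) / ε))
    (-A * (x - (p + q) / 2) ^ 2 - B * ((p - q) / ε) ^ 2) k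
  have e : ∀ k : ℝ, kerK A B ε x k p q = Complex.exp (0 * k ^ 2 +
      (-2 * π * Complex.I * ((p - q) / ε)) * k +
      (-A * (x - (p + q) / 2) ^ 2 - B * ((p - q) / ε) ^ 2)) := by
    intro k
    unfold kerK
    congr 1
    push_cast
    ring
  simp_rw [e]
  refine h.congr_deriv ?_
  ring

lemma kerK_dp (A B ε x k p q : ℝ) :
    HasDerivAt (fun p => kerK A B ε x k p q) (kLp A B ε x k p q * kerK A B ε x k p q) p ∧
    HasDerivAt (fun p => kLp A B ε x k p q * kerK A B ε x k p q)
      ((kLp A B ε x k p q ^ 2 - (A / 2 + 2 * B / ε ^ 2)) * kerK A B ε x k p q) p := by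
  set α : ℂ := -A / 4 - B / ε ^ 2 with hα
  set β : ℂ := A * (x - q / 2) + 2 * B * q / ε ^ 2 - 2 * π * Complex.I * k / ε with hβ
  set γ : ℂ := -A * (x - q / 2) ^ 2 - B * q ^ 2 / ε ^ 2 + 2 * π * Complex.I * k * q / ε with hγ
  have e : ∀ p : ℝ, kerK A B ε x k p q = Complex.exp (α * p ^ 2 + β * p + γ) := by
    intro p
    unfold kerK
    congr 1
    rw [hα, hβ, hγ]
    push_cast
    ring
  have e2 : ∀ p : ℝ, kLp A B ε x k p q = 2 * α * p + β := by
    intro p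
    unfold kLp
    rw [hα, hβ]
    ring
  have e3 : -((A : ℂ) / 2 + 2 * B / ε ^ 2) = 2 * α := by rw [hα]; ring
  simp_rw [e, e2, sub_eq_add_neg, e3]
  exact ⟨gexp1 α β γ p, gexp2 α β γ p⟩

lemma kerK_dq (A B ε x k p q : ℝ) :
    HasDerivAt (fun q => kerK A B ε x k p q) (kLq A B ε x k p q * kerK A B ε x k p q) q ∧
    HasDerivAt (fun q => kLq A B ε x k p q * kerK A B ε x k p q)
      ((kLq A B ε x k p q ^ 2 - (A / 2 + 2 * B / ε ^ 2)) * kerK A B ε x k p q) q := by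
  set α : ℂ := -A / 4 - B / ε ^ 2 with hα
  set β : ℂ := A * (x - p / 2) + 2 * B * p / ε ^ 2 + 2 * π * Complex.I * k / ε with hβ
  set γ : ℂ := -A * (x - p / 2) ^ 2 - B * p ^ 2 / ε ^ 2 - 2 * π * Complex.I * k * p / ε with hγ
  have e : ∀ q : ℝ, kerK A B ε x k p q = Complex.exp (α * q ^ 2 + β * q + γ) := by
    intro q
    unfold kerK
    congr 1
    rw [hα, hβ, hγ]
    push_cast
    ring
  have e2 : ∀ q : ℝ, kLq A B ε x k p q = 2 * α * q + β := by
    intro q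
    unfold kLq
    rw [hα, hβ]
    ring
  have e3 : -((A : ℂ) / 2 + 2 * B / ε ^ 2) = 2 * α := by rw [hα]; ring
  simp_rw [e, e2, sub_eq_add_neg, e3]
  exact ⟨gexp1 α β γ q, gexp2 α β γ q⟩

lemma lin1 (x p q : ℝ) : ‖((x : ℂ) - (p + q) / 2)‖ ≤ (|x| + 1) * (1 + |p| + |q|) := by
  have : ((x : ℂ) - (p + q) / 2) = ((x - (p + q) / 2 : ℝ) : ℂ) := by push_cast; ring
  rw [this, Complex.norm_real, Real.norm_eq_abs]
  have h1 : |x - (p + q) / 2| ≤ |x| + (|p| + |q|) / 2 := by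
    rw [abs_le]
    constructor <;> linarith [neg_abs_le x, neg_abs_le p, neg_abs_le q, le_abs_self x,
      le_abs_self p, le_abs_self q]
  nlinarith [abs_nonneg x, abs_nonneg p, abs_nonneg q, mul_nonneg (abs_nonneg x) (abs_nonneg p),
    mul_nonneg (abs_nonneg x) (abs_nonneg q)]

lemma lin2 {ε : ℝ} (hε : 0 < ε) (p q : ℝ) :
    ‖(((p : ℂ) - q) / ε)‖ ≤ ε⁻¹ * (1 + |p| + |q|) := by
  have : (((p : ℂ) - q) / ε) = ((ε⁻¹ * (p - q) : ℝ) : ℂ) := by push_cast; ring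
  rw [this, Complex.norm_real, Real.norm_eq_abs, abs_mul, abs_of_pos (inv_pos.2 hε)]
  gcongr
  rw [abs_le]
  constructor <;> linarith [neg_abs_le p, neg_abs_le q, le_abs_self p, le_abs_self q]

lemma rho_one (p q : ℝ) : 1 ≤ 1 + |p| + |q| := by
  linarith [abs_nonneg p, abs_nonneg q]

lemma lin_ab {ε : ℝ} (hε : 0 < ε) (x p q : ℝ) {c1 c2 c3 : ℂ} :
    ‖c1 * ((x : ℂ) - (p + q) / 2) + c2 * (((p : ℂ) - q) / ε) + c3‖ ≤
      (‖c1‖ * (|x| + 1) + ‖c2‖ * ε⁻¹ + ‖c3‖) * (1 + |p| + |q|) := by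
  have h1 := lin1 x p q
  have h2 := lin2 hε p q
  have h3 := rho_one p q
  calc _ ≤ ‖c1‖ * ‖((x : ℂ) - (p + q) / 2)‖ + ‖c2‖ * ‖(((p : ℂ) - q) / ε)‖ + ‖c3‖ * 1 := by
        refine (norm_add₃_le).trans ?_
        rw [norm_mul, norm_mul, mul_one]
    _ ≤ ‖c1‖ * ((|x| + 1) * (1 + |p| + |q|)) + ‖c2‖ * (ε⁻¹ * (1 + |p| + |q|))
        + ‖c3‖ * (1 + |p| + |q|) := by gcongr
    _ = _ := by ring

lemma kL_bound (A B ε : ℝ) (hε : 0 < ε) (x k : ℝ) : ∃ N : ℝ, 0 ≤ N ∧ ∀ p q : ℝ,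
    ‖kLp A B ε x k p q‖ ≤ N * (1 + |p| + |q|) ∧ ‖kLq A B ε x k p q‖ ≤ N * (1 + |p| + |q|) := by
  refine ⟨‖(A : ℂ)‖ * (|x| + 1) + ‖(2 * B / ε : ℂ)‖ * ε⁻¹ + ‖(2 * π * Complex.I * k / ε : ℂ)‖,
    by positivity, fun p q => ⟨?_, ?_⟩⟩
  · have := lin_ab hε x p q (c1 := A) (c2 := -(2 * B / ε)) (c3 := -(2 * π * Complex.I * k / ε))
    rw [norm_neg, norm_neg] at this
    refine le_trans (le_of_eq ?_) this
    unfold kLp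
    congr 1
    ring
  · exact lin_ab hε x p q (c1 := A) (c2 := (2 * B / ε)) (c3 := (2 * π * Complex.I * k / ε))

lemma ker_bounds {A B ε : ℝ} (hA : 0 ≤ A) (hB : 0 ≤ B) (hε : 0 < ε) (x k : ℝ) :
    ∃ M : ℝ, 0 ≤ M ∧ ∀ p q : ℝ,
    ‖kerK A B ε x k p q‖ ≤ M * (1 + |p| + |q|) ^ 2 ∧
    ‖kLp A B ε x k p q * kerK A B ε x k p q‖ ≤ M * (1 + |p| + |q|) ^ 2 ∧
    ‖kLq A B ε x k p q * kerK A B ε x k p q‖ ≤ M * (1 + |p| + |q|) ^ 2 ∧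
    ‖(kLp A B ε x k p q ^ 2 - (A / 2 + 2 * B / ε ^ 2)) * kerK A B ε x k p q‖
      ≤ M * (1 + |p| + |q|) ^ 2 ∧
    ‖(kLq A B ε x k p q ^ 2 - (A / 2 + 2 * B / ε ^ 2)) * kerK A B ε x k p q‖
      ≤ M * (1 + |p| + |q|) ^ 2 := by
  obtain ⟨N, hN, hb⟩ := kL_bound A B ε hε x k
  set D : ℝ := ‖((A : ℂ) / 2 + 2 * B / ε ^ 2)‖ with hD
  have hD0 : 0 ≤ D := norm_nonneg _
  refine ⟨(N + 1) ^ 2 + D, by positivity, fun p q => ?_⟩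
  have h1 := kerK_norm hA hB ε x k p q
  obtain ⟨h2, h3⟩ := hb p q
  have hr := rho_one p q
  set r := 1 + |p| + |q|
  have hr2 : r ≤ r ^ 2 := by nlinarith
  have hr3 : 1 ≤ r ^ 2 := by nlinarith
  have aux1 : ∀ l : ℂ, ‖l‖ ≤ N * r → ‖l * kerK A B ε x k p q‖ ≤ ((N + 1) ^ 2 + D) * r ^ 2 := by
    intro l hl
    rw [norm_mul]
    calc ‖l‖ * ‖kerK A B ε x k p q‖ ≤ (N * r) * 1 := by gcongr
      _ ≤ N * r ^ 2 := by rw [mul_one]; gcongr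
      _ ≤ _ := by gcongr; nlinarith
  have aux2 : ∀ l : ℂ, ‖l‖ ≤ N * r → ‖(l ^ 2 - (A / 2 + 2 * B / ε ^ 2)) * kerK A B ε x k p q‖
      ≤ ((N + 1) ^ 2 + D) * r ^ 2 := by
    intro l hl
    rw [norm_mul]
    calc _ ≤ ((N * r) ^ 2 + D) * 1 := by
          gcongr
          refine (norm_sub_le _ _).trans ?_
          rw [norm_pow]
          gcongr
      _ ≤ N ^ 2 * r ^ 2 + D * r ^ 2 := by nlinarith
      _ ≤ _ := by nlinarith
  refine ⟨h1.trans ?_, aux1 _ h2, aux1 _ h3, aux2 _ h2, aux2 _ h3⟩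
  nlinarith

lemma kLp_cont (A B ε x k : ℝ) : Continuous (fun z : ℝ × ℝ => kLp A B ε x k z.1 z.2) := by
  unfold kLp
  fun_prop

lemma kLq_cont (A B ε x k : ℝ) : Continuous (fun z : ℝ × ℝ => kLq A B ε x k z.1 z.2) := by
  unfold kLq
  fun_prop

lemma int_fg {C D M : ℝ} {f g : ℝ → ℂ} (hf : Dec C f) (hg : Dec D g) {m : ℝ × ℝ → ℂ}
    (hc : Continuous m) (hm : ∀ p q, ‖m (p, q)‖ ≤ M * (1 + |p| + |q|) ^ 2) :
    Integrable (fun z : ℝ × ℝ => m z * (f z.1 * g z.2)) :=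
  int_of (M := 3 * M * C * D)
    (hc.mul ((hf.1.comp continuous_fst).mul (hg.1.comp continuous_snd)))
    (fun z => bound_of hf hg (hm z.1 z.2))

lemma ibp_abs_p {K L P : ℝ → ℝ → ℂ} {M : ℝ} (hM : 0 ≤ M)
    (cK : Continuous (fun z : ℝ × ℝ => K z.1 z.2)) (cL : Continuous (fun z : ℝ × ℝ => L z.1 z.2))
    (cP : Continuous (fun z : ℝ × ℝ => P z.1 z.2))
    (bK : ∀ p q, ‖K p q‖ ≤ M * (1 + |p| + |q|) ^ 2)
    (bL : ∀ p q, ‖L p q‖ ≤ M * (1 + |p| + |q|) ^ 2)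
    (bP : ∀ p q, ‖P p q‖ ≤ M * (1 + |p| + |q|) ^ 2)
    (dK : ∀ p q, HasDerivAt (fun p => K p q) (L p q) p)
    (dL : ∀ p q, HasDerivAt (fun p => L p q) (P p q) p)
    {C C' C'' D : ℝ} {f f' f'' g : ℝ → ℂ} (hf : Dec C f) (hf' : Dec C' f') (hf'' : Dec C'' f'')
    (hg : Dec D g) (df : ∀ p, HasDerivAt f (f' p) p) (df' : ∀ p, HasDerivAt f' (f'' p) p) :
    ∫ z : ℝ × ℝ, K z.1 z.2 * (f'' z.1 * g z.2) = ∫ z : ℝ × ℝ, P z.1 z.2 * (f z.1 * g z.2) := by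
  have i1 := int_fg hf'' hg cK bK
  have i2 := int_fg hf hg cP bP
  rw [Measure.volume_eq_prod] at i1 i2 ⊢
  rw [integral_prod_symm _ i1, integral_prod_symm _ i2]
  congr 1
  ext q
  simp only [← mul_assoc]
  rw [integral_mul_const, integral_mul_const]
  congr 1
  have hq : Continuous (fun p : ℝ => (p, q)) := by fun_prop
  have up : ∀ {v : ℝ} {p : ℝ}, v ≤ M * (1 + |p| + |q|) ^ 2 →
      v ≤ (M * 3 * (1 + q ^ 2)) * (1 + p ^ 2) := by
    intro v p h
    refine h.trans ((mul_le_mul_of_nonneg_left (rho_sq p q) hM).trans (le_of_eq (by ring)))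
  exact ibp2 (cK.comp hq) (cL.comp hq) (cP.comp hq)
    (fun p => up (bK p q)) (fun p => up (bL p q)) (fun p => up (bP p q))
    (fun p => dK p q) (fun p => dL p q)
    hf hf' hf'' df df'

lemma ibp_abs_q {K L P : ℝ → ℝ → ℂ} {M : ℝ} (hM : 0 ≤ M)
    (cK : Continuous (fun z : ℝ × ℝ => K z.1 z.2)) (cL : Continuous (fun z : ℝ × ℝ => L z.1 z.2))
    (cP : Continuous (fun z : ℝ × ℝ => P z.1 z.2))
    (bK : ∀ p q, ‖K p q‖ ≤ M * (1 + |p| + |q|) ^ 2)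
    (bL : ∀ p q, ‖L p q‖ ≤ M * (1 + |p| + |q|) ^ 2)
    (bP : ∀ p q, ‖P p q‖ ≤ M * (1 + |p| + |q|) ^ 2)
    (dK : ∀ p q, HasDerivAt (fun q => K p q) (L p q) q)
    (dL : ∀ p q, HasDerivAt (fun q => L p q) (P p q) q)
    {C C' C'' D : ℝ} {f f' f'' g : ℝ → ℂ} (hf : Dec C f) (hf' : Dec C' f') (hf'' : Dec C'' f'')
    (hg : Dec D g) (df : ∀ p, HasDerivAt f (f' p) p) (df' : ∀ p, HasDerivAt f' (f'' p) p) :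
    ∫ z : ℝ × ℝ, K z.1 z.2 * (g z.1 * f'' z.2) = ∫ z : ℝ × ℝ, P z.1 z.2 * (g z.1 * f z.2) := by
  have i1 := int_fg hg hf'' cK bK
  have i2 := int_fg hg hf cP bP
  rw [Measure.volume_eq_prod] at i1 i2 ⊢
  rw [integral_prod _ i1, integral_prod _ i2]
  congr 1
  ext p
  simp only [mul_left_comm _ (g p) _]
  rw [integral_const_mul, integral_const_mul]
  congr 1
  have hq : Continuous (fun q : ℝ => (p, q)) := by fun_prop
  have up : ∀ {v : ℝ} {q : ℝ}, v ≤ M * (1 + |p| + |q|) ^ 2 →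
      v ≤ (M * 3 * (1 + p ^ 2)) * (1 + q ^ 2) := by
    intro v q h
    refine h.trans ((mul_le_mul_of_nonneg_left (rho_sq p q) hM).trans (le_of_eq (by ring)))
  exact ibp2 (cK.comp hq) (cL.comp hq) (cP.comp hq)
    (fun q => up (bK p q)) (fun q => up (bL p q)) (fun q => up (bP p q))
    (fun q => dK p q) (fun q => dL p q)
    hf hf' hf'' df df'

lemma ibp_p {A B ε : ℝ} (hA : 0 ≤ A) (hB : 0 ≤ B) (hε : 0 < ε) (x k : ℝ)
    {C C' C'' D : ℝ} {f f' f'' g : ℝ → ℂ} (hf : Dec C f) (hf' : Dec C' f') (hf'' : Dec C'' f'')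
    (hg : Dec D g) (df : ∀ p, HasDerivAt f (f' p) p) (df' : ∀ p, HasDerivAt f' (f'' p) p) :
    ∫ z : ℝ × ℝ, kerK A B ε x k z.1 z.2 * (f'' z.1 * g z.2) =
    ∫ z : ℝ × ℝ, ((kLp A B ε x k z.1 z.2 ^ 2 - (A / 2 + 2 * B / ε ^ 2)) *
      kerK A B ε x k z.1 z.2) * (f z.1 * g z.2) := by
  obtain ⟨M, hM, hb⟩ := ker_bounds hA hB hε x k
  have cK := kerK_cont A B ε x k
  have cL := kLp_cont A B ε x k
  have c1 : Continuous (fun z : ℝ × ℝ => kLp A B ε x k z.1 z.2 * kerK A B ε x k z.1 z.2) :=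
    cL.mul cK
  have c2 : Continuous (fun z : ℝ × ℝ => (kLp A B ε x k z.1 z.2 ^ 2 - (A / 2 + 2 * B / ε ^ 2)) *
      kerK A B ε x k z.1 z.2) := ((cL.pow 2).sub continuous_const).mul cK
  exact ibp_abs_p (K := kerK A B ε x k)
    (L := fun p q => kLp A B ε x k p q * kerK A B ε x k p q)
    (P := fun p q => (kLp A B ε x k p q ^ 2 - (A / 2 + 2 * B / ε ^ 2)) * kerK A B ε x k p q)
    hM cK c1 c2 (fun p q => (hb p q).1) (fun p q => (hb p q).2.1) (fun p q => (hb p q).2.2.2.1)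
    (fun p q => (kerK_dp A B ε x k p q).1) (fun p q => (kerK_dp A B ε x k p q).2)
    hf hf' hf'' hg df df'

lemma ibp_q {A B ε : ℝ} (hA : 0 ≤ A) (hB : 0 ≤ B) (hε : 0 < ε) (x k : ℝ)
    {C C' C'' D : ℝ} {f f' f'' g : ℝ → ℂ} (hf : Dec C f) (hf' : Dec C' f') (hf'' : Dec C'' f'')
    (hg : Dec D g) (df : ∀ p, HasDerivAt f (f' p) p) (df' : ∀ p, HasDerivAt f' (f'' p) p) :
    ∫ z : ℝ × ℝ, kerK A B ε x k z.1 z.2 * (g z.1 * f'' z.2) =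
    ∫ z : ℝ × ℝ, ((kLq A B ε x k z.1 z.2 ^ 2 - (A / 2 + 2 * B / ε ^ 2)) *
      kerK A B ε x k z.1 z.2) * (g z.1 * f z.2) := by
  obtain ⟨M, hM, hb⟩ := ker_bounds hA hB hε x k
  have cK := kerK_cont A B ε x k
  have cL := kLq_cont A B ε x k
  have c1 : Continuous (fun z : ℝ × ℝ => kLq A B ε x k z.1 z.2 * kerK A B ε x k z.1 z.2) :=
    cL.mul cK
  have c2 : Continuous (fun z : ℝ × ℝ => (kLq A B ε x k z.1 z.2 ^ 2 - (A / 2 + 2 * B / ε ^ 2)) *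
      kerK A B ε x k z.1 z.2) := ((cL.pow 2).sub continuous_const).mul cK
  exact ibp_abs_q (K := kerK A B ε x k)
    (L := fun p q => kLq A B ε x k p q * kerK A B ε x k p q)
    (P := fun p q => (kLq A B ε x k p q ^ 2 - (A / 2 + 2 * B / ε ^ 2)) * kerK A B ε x k p q)
    hM cK c1 c2 (fun p q => (hb p q).1) (fun p q => (hb p q).2.2.1) (fun p q => (hb p q).2.2.2.2)
    (fun p q => (kerK_dq A B ε x k p q).1) (fun p q => (kerK_dq A B ε x k p q).2)
    hf hf' hf'' hg df df'


lemma J_dx {A B ε : ℝ} (hA : 0 ≤ A) (hB : 0 ≤ B) (x k : ℝ)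
    {C D N : ℝ} {f g : ℝ → ℂ} (hf : Dec C f) (hg : Dec D g) {m : ℝ × ℝ → ℂ}
    (hc : Continuous m) (hN : 0 ≤ N) (hm : ∀ p q, ‖m (p, q)‖ ≤ N * (1 + |p| + |q|)) :
    HasDerivAt (fun x => ∫ z : ℝ × ℝ, (m z * kerK A B ε x k z.1 z.2) * (f z.1 * g z.2))
      (∫ z : ℝ × ℝ, (m z * ((-2 * A * (x - (z.1 + z.2) / 2)) * kerK A B ε x k z.1 z.2)) *
        (f z.1 * g z.2)) x := by
  have cfg : Continuous (fun z : ℝ × ℝ => f z.1 * g z.2) :=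
    (hf.1.comp continuous_fst).mul (hg.1.comp continuous_snd)
  refine deriv_param (M := 3 * N * C * D) (M' := 3 * (N * (2 * A * (|x| + 2))) * C * D)
    (F' := fun x z => (m z * ((-2 * A * (x - (z.1 + z.2) / 2)) * kerK A B ε x k z.1 z.2)) *
        (f z.1 * g z.2))
    (fun x => (hc.mul (kerK_cont A B ε x k)).mul cfg) ?_ ?_ ?_ ?_
  · exact (hc.mul (Continuous.mul (by fun_prop) (kerK_cont A B ε x k))).mul cfg
  · rintro ⟨p, q⟩
    refine bound_of hf hg ?_
    rw [norm_mul]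
    have h1 := kerK_norm hA hB ε x k p q
    have h2 := hm p q
    have h3 := rho_one p q
    calc ‖m (p, q)‖ * ‖kerK A B ε x k p q‖ ≤ N * (1 + |p| + |q|) * 1 := by gcongr
      _ ≤ N * (1 + |p| + |q|) * (1 + |p| + |q|) := by gcongr
      _ = _ := by ring
  · rintro x' hx' ⟨p, q⟩
    refine bound_of hf hg ?_
    have hx2 : |x'| ≤ |x| + 1 := by
      rw [Metric.mem_ball, Real.dist_eq] at hx'
      have := abs_sub_abs_le_abs_sub x' x
      linarith
    have h1 := kerK_norm hA hB ε x' k p q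
    have h2 := hm p q
    have h3 := rho_one p q
    have h4 : ‖((x' : ℂ) - (p + q) / 2)‖ ≤ (|x| + 2) * (1 + |p| + |q|) :=
      (lin1 x' p q).trans (mul_le_mul_of_nonneg_right (by linarith) (by linarith))
    rw [norm_mul, norm_mul, norm_mul, norm_mul, Complex.norm_real, Real.norm_eq_abs,
      abs_of_nonneg hA, norm_neg, Complex.norm_ofNat]
    calc _ ≤ N * (1 + |p| + |q|) * ((2 * A * ((|x| + 2) * (1 + |p| + |q|))) * 1) := by gcongr
      _ = _ := by ring
  · intro x' z
    exact ((kerK_dx A B ε x' k z.1 z.2).const_mul (m z)).mul_const _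

lemma J_dk {A B ε : ℝ} (hA : 0 ≤ A) (hB : 0 ≤ B) (hε : 0 < ε) (x k : ℝ)
    {C D : ℝ} {f g : ℝ → ℂ} (hf : Dec C f) (hg : Dec D g) :
    HasDerivAt (fun k => ∫ z : ℝ × ℝ, kerK A B ε x k z.1 z.2 * (f z.1 * g z.2))
      (∫ z : ℝ × ℝ, ((-2 * π * Complex.I * ((z.1 - z.2) / ε)) * kerK A B ε x k z.1 z.2) *
        (f z.1 * g z.2)) k := by
  have cfg : Continuous (fun z : ℝ × ℝ => f z.1 * g z.2) :=
    (hf.1.comp continuous_fst).mul (hg.1.comp continuous_snd)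
  refine deriv_param (M := 3 * 1 * C * D) (M' := 3 * (2 * π * ε⁻¹) * C * D)
    (F' := fun k z => ((-2 * π * Complex.I * ((z.1 - z.2) / ε)) * kerK A B ε x k z.1 z.2) *
        (f z.1 * g z.2))
    (fun k => (kerK_cont A B ε x k).mul cfg) ?_ ?_ ?_ ?_
  · exact (Continuous.mul (by fun_prop) (kerK_cont A B ε x k)).mul cfg
  · rintro ⟨p, q⟩
    refine bound_of hf hg ?_
    have h1 := kerK_norm hA hB ε x k p q
    have h3 := rho_one p q
    refine h1.trans ?_
    nlinarith
  · rintro k' hk' ⟨p, q⟩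
    refine bound_of hf hg ?_
    have h1 := kerK_norm hA hB ε x k' p q
    have h2 := lin2 hε p q
    have h3 := rho_one p q
    have h5 := Real.pi_pos
    rw [norm_mul, norm_mul, norm_mul, norm_mul, Complex.norm_real, Real.norm_eq_abs,
      abs_of_pos Real.pi_pos, norm_neg, Complex.norm_ofNat, Complex.norm_I]
    calc _ ≤ (2 * π * 1 * (ε⁻¹ * (1 + |p| + |q|))) * 1 := by gcongr
      _ = 2 * π * ε⁻¹ * (1 + |p| + |q|) ^ 1 := by ring
      _ ≤ _ := by
        rw [pow_one]
        refine mul_le_mul_of_nonneg_left ?_ (by positivity)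
        nlinarith
  · intro k' z
    exact (kerK_dk A B ε x k' z.1 z.2).mul_const _

lemma dec_unif {F : ℝ → ℝ → ℂ} {T : ℝ} (hc : ∀ t, Continuous (F t))
    (h : ∀ n : ℕ, ∃ C : ℝ, ∀ t x : ℝ, |t| ≤ T → |x| ^ n * ‖F t x‖ ≤ C) :
    ∃ C, ∀ t, |t| ≤ T → Dec C (F t) := by
  obtain ⟨C0, h0⟩ := h 0
  obtain ⟨C4, h4⟩ := h 4
  refine ⟨2 * (C0 + C4), fun t ht => ⟨hc t, fun p => ?_⟩⟩
  have a0 := h0 t p ht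
  have a4 := h4 t p ht
  have e4 : |p| ^ 4 = p ^ 4 := by
    rw [show (4 : ℕ) = 2 * 2 by rfl, pow_mul, pow_mul, sq_abs]
  rw [pow_zero, one_mul] at a0
  rw [e4] at a4
  rw [inv_pow, ← div_eq_mul_inv, le_div_iff₀ (by positivity)]
  have hn := norm_nonneg (F t p)
  have : (1 + p ^ 2) ^ 2 ≤ 2 * (1 + p ^ 4) := by nlinarith [sq_nonneg (p ^ 2 - 1)]
  calc ‖F t p‖ * (1 + p ^ 2) ^ 2 ≤ ‖F t p‖ * (2 * (1 + p ^ 4)) := by gcongr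
    _ ≤ _ := by linarith

lemma J_dt {A B ε : ℝ} (hA : 0 ≤ A) (hB : 0 ≤ B) (x k t : ℝ) {C C' : ℝ} {U U' : ℝ → ℝ → ℂ}
    (hcU : ∀ s, Continuous (U s))
    (hU : ∀ s, |s| ≤ |t| + 1 → Dec C (U s)) (hU' : ∀ s, |s| ≤ |t| + 1 → Dec C' (U' s))
    (hd : ∀ s p, HasDerivAt (fun s => U s p) (U' s p) s) :
    HasDerivAt (fun s => ∫ z : ℝ × ℝ, kerK A B ε x k z.1 z.2 *
        (U s z.1 * (starRingEnd ℂ) (U s z.2)))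
      (∫ z : ℝ × ℝ, (kerK A B ε x k z.1 z.2 * (U' t z.1 * (starRingEnd ℂ) (U t z.2)) +
        kerK A B ε x k z.1 z.2 * (U t z.1 * (starRingEnd ℂ) (U' t z.2)))) t := by
  have ht : |t| ≤ |t| + 1 := by linarith
  have cK := kerK_cont A B ε x k
  have hk : ∀ p q, ‖kerK A B ε x k p q‖ ≤ 1 * (1 + |p| + |q|) ^ 2 := by
    intro p q
    have h3 := rho_one p q
    refine (kerK_norm hA hB ε x k p q).trans ?_
    nlinarith
  have c1 : ∀ {f g : ℝ → ℂ}, Continuous f → Continuous g → Continuous (fun z : ℝ × ℝ =>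
      kerK A B ε x k z.1 z.2 * (f z.1 * (starRingEnd ℂ) (g z.2))) := fun hf hg =>
    cK.mul ((hf.comp continuous_fst).mul (Complex.continuous_conj.comp (hg.comp continuous_snd)))
  refine deriv_param (M := 3 * 1 * C * C) (M' := 3 * 1 * C' * C + 3 * 1 * C * C')
    (F' := fun s z => (kerK A B ε x k z.1 z.2 * (U' s z.1 * (starRingEnd ℂ) (U s z.2)) +
        kerK A B ε x k z.1 z.2 * (U s z.1 * (starRingEnd ℂ) (U' s z.2))))
    (fun s => c1 (hcU s) (hcU s)) ?_ ?_ ?_ ?_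
  · exact (c1 (hU' t ht).1 (hcU t)).add (c1 (hcU t) (hU' t ht).1)
  · rintro ⟨p, q⟩
    exact bound_of (hU t ht) (hU t ht).conj (hk p q)
  · rintro s hs ⟨p, q⟩
    have hs2 : |s| ≤ |t| + 1 := by
      rw [Metric.mem_ball, Real.dist_eq] at hs
      have := abs_sub_abs_le_abs_sub s t
      linarith
    refine (norm_add_le _ _).trans ?_
    rw [add_mul]
    exact add_le_add (bound_of (hU' s hs2) (hU s hs2).conj (hk p q))
      (bound_of (hU s hs2) (hU' s hs2).conj (hk p q))
  · intro s z
    have h1 := hd s z.1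
    have h2 : HasDerivAt (fun s => (starRingEnd ℂ) (U s z.2)) ((starRingEnd ℂ) (U' s z.2)) s :=
      (hd s z.2).star
    refine ((h1.mul h2).const_mul (kerK A B ε x k z.1 z.2)).congr_deriv ?_
    ring

lemma int_l {A B ε : ℝ} (hA : 0 ≤ A) (hB : 0 ≤ B) (x k : ℝ) {C D : ℝ} {f g : ℝ → ℂ}
    (hf : Dec C f) (hg : Dec D g) (l : ℝ × ℝ → ℂ) (hc : Continuous l)
    (hl : ∃ M, ∀ p q, ‖l (p, q)‖ ≤ M * (1 + |p| + |q|) ^ 2) :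
    Integrable (fun z : ℝ × ℝ => (l z * kerK A B ε x k z.1 z.2) * (f z.1 * g z.2)) := by
  obtain ⟨M, hM⟩ := hl
  refine int_fg (M := M) (m := fun z : ℝ × ℝ => l z * kerK A B ε x k z.1 z.2) hf hg
    (hc.mul (kerK_cont A B ε x k)) fun p q => ?_
  have h1 := kerK_norm hA hB ε x k p q
  rw [norm_mul]
  calc _ ≤ ‖l (p, q)‖ * 1 := by gcongr
    _ ≤ _ := by rw [mul_one]; exact hM p q

lemma V_bound (a b c p q : ℝ) :
    ‖(((a * p ^ 2 + b * p + c : ℝ) : ℂ) - ((a * q ^ 2 + b * q + c : ℝ) : ℂ))‖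
      ≤ (|a| + |b|) * (1 + |p| + |q|) ^ 2 := by
  rw [← Complex.ofReal_sub, Complex.norm_real, Real.norm_eq_abs]
  have h1 : (a * p ^ 2 + b * p + c) - (a * q ^ 2 + b * q + c)
    = a * (p ^ 2 - q ^ 2) + b * (p - q) := by ring
  rw [h1]
  refine (abs_add_le _ _).trans ?_
  rw [abs_mul, abs_mul, add_mul]
  have hp := abs_nonneg p
  have hq := abs_nonneg q
  have h2 : |p ^ 2 - q ^ 2| ≤ (1 + |p| + |q|) ^ 2 := by
    have := abs_sub (p ^ 2) (q ^ 2)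
    rw [abs_pow, abs_pow] at this
    nlinarith
  have h3 : |p - q| ≤ (1 + |p| + |q|) ^ 2 := by
    have := abs_sub p q
    nlinarith
  gcongr

lemma lin3 {F1 F2 F3 G : ℝ × ℝ → ℂ} (h1 : Integrable F1) (h2 : Integrable F2)
    (h3 : Integrable F3) (c1 c2 c3 : ℂ) (h : ∀ z, G z = c1 * F1 z - c2 * F2 z - c3 * F3 z) :
    ∫ z, G z = c1 * (∫ z, F1 z) - c2 * (∫ z, F2 z) - c3 * (∫ z, F3 z) := by
  simp_rw [h]
  have k1 : Integrable (fun z => c1 * F1 z) := h1.const_mul _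
  have k2 : Integrable (fun z => c2 * F2 z) := h2.const_mul _
  have k3 : Integrable (fun z => c3 * F3 z) := h3.const_mul _
  have k12 : Integrable (fun z => c1 * F1 z - c2 * F2 z) := k1.sub k2
  rw [integral_sub k12 k3, integral_sub k1 k2]
  simp only [integral_const_mul]

lemma lin6 {F1 F2 F3 F4 F5 F6 : ℝ × ℝ → ℂ} (h1 : Integrable F1) (h2 : Integrable F2)
    (h3 : Integrable F3) (h4 : Integrable F4) (h5 : Integrable F5) (h6 : Integrable F6)
    (c1 c2 c3 c4 c5 c6 : ℂ)
    (h : ∀ z, c1 * F1 z + c2 * F2 z + c3 * F3 z + c4 * F4 z + c5 * F5 z + c6 * F6 z = 0) :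
    c1 * (∫ z, F1 z) + c2 * (∫ z, F2 z) + c3 * (∫ z, F3 z) + c4 * (∫ z, F4 z)
      + c5 * (∫ z, F5 z) + c6 * (∫ z, F6 z) = 0 := by
  have k1 : Integrable (fun z => c1 * F1 z) := h1.const_mul _
  have k2 : Integrable (fun z => c2 * F2 z) := h2.const_mul _
  have k3 : Integrable (fun z => c3 * F3 z) := h3.const_mul _
  have k4 : Integrable (fun z => c4 * F4 z) := h4.const_mul _
  have k5 : Integrable (fun z => c5 * F5 z) := h5.const_mul _
  have k6 : Integrable (fun z => c6 * F6 z) := h6.const_mul _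
  have l2 : Integrable (fun z => c1 * F1 z + c2 * F2 z) := k1.add k2
  have l3 : Integrable (fun z => c1 * F1 z + c2 * F2 z + c3 * F3 z) := l2.add k3
  have l4 : Integrable (fun z => c1 * F1 z + c2 * F2 z + c3 * F3 z + c4 * F4 z) := l3.add k4
  have l5 : Integrable (fun z => c1 * F1 z + c2 * F2 z + c3 * F3 z + c4 * F4 z + c5 * F5 z) :=
    l4.add k5
  simp only [← integral_const_mul]
  rw [← integral_add k1 k2, ← integral_add l2 k3, ← integral_add l3 k4, ← integral_add l4 k5,
    ← integral_add l5 k6]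
  simp only [h, integral_zero]

/-- Exact closed equation for the smoothed Wigner transform of a solution of the Schrödinger
equation with quadratic potential `V(x) = a x² + b x + c`: setting
`W̃(x,k,t) = W̃^{σx,σk;ε}[u(·,t)](x,k)`, one has, exactly (no error term),
`∂_t W̃ + 2πk ∂_x W̃ - (V'(x)/(2π)) ∂_k W̃ + ε (σk²/2 - V''(x) σx²/(8π²)) ∂²_{xk} W̃ = 0`,
where `V'(x) = 2ax + b` and `V''(x) = 2a`. -/
theorem swt_quadratic_exact (ε σx σk : ℝ) (hε : 0 < ε) (hσx : 0 < σx) (hσk : 0 < σk)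
    (a b c : ℝ) (u : ℝ → ℝ → ℂ)
    (hu_smooth : ContDiff ℝ (⊤ : ℕ∞) (fun p : ℝ × ℝ => u p.1 p.2))
    (hu_schwartz : ∀ n m : ℕ, ∀ T : ℝ, ∃ C : ℝ, ∀ t x : ℝ, |t| ≤ T →
      |x| ^ n * ‖iteratedDeriv m (fun x' => u x' t) x‖ ≤ C)
    (hut_schwartz : ∀ n m : ℕ, ∀ T : ℝ, ∃ C : ℝ, ∀ t x : ℝ, |t| ≤ T →
      |x| ^ n * ‖iteratedDeriv m (fun x' => deriv (fun s => u x' s) t) x‖ ≤ C)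
    (heq : ∀ x t : ℝ, (ε : ℂ) * deriv (fun s => u x s) t
      - Complex.I * ε ^ 2 / 2 * iteratedDeriv 2 (fun x' => u x' t) x
      + Complex.I * ((a * x ^ 2 + b * x + c : ℝ) : ℂ) * u x t = 0) :
    ∀ x k t : ℝ,
      deriv (fun s => swt ε σx σk (fun x' => u x' s) (fun x' => u x' s) x k) t
        + 2 * π * k * deriv (fun x' => swt ε σx σk (fun y => u y t) (fun y => u y t) x' k) x
        - (2 * a * x + b) / (2 * π) *
            deriv (fun k' => swt ε σx σk (fun y => u y t) (fun y => u y t) x k') k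
        + ε * (σk ^ 2 / 2 - 2 * a * σx ^ 2 / (8 * π ^ 2)) *
            deriv (fun x' =>
              deriv (fun k' => swt ε σx σk (fun y => u y t) (fun y => u y t) x' k') k) x
        = 0 := by
  intro x k t
  set A := 2 * π / (ε * σx ^ 2) with hA
  set B := π * ε * σk ^ 2 / 2 with hB
  have hA0 : 0 ≤ A := by positivity
  have hB0 : 0 ≤ B := by positivity
  have hεC : (ε : ℂ) ≠ 0 := by exact_mod_cast hε.ne'
  obtain ⟨c₀, hswt⟩ := swt_eq_s16 hε hσx hσk
  rw [← hA, ← hB] at hswt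
  -- regularity
  have smx : ∀ s, ContDiff ℝ (⊤ : ℕ∞) (fun p => u p s) := fun s =>
    hu_smooth.comp (contDiff_id.prodMk contDiff_const)
  have smt : ∀ p, ContDiff ℝ (⊤ : ℕ∞) (fun s => u p s) := fun p =>
    hu_smooth.comp (contDiff_const.prodMk contDiff_id)
  have cit : ∀ (n : ℕ) s, Continuous (iteratedDeriv n (fun p => u p s)) := fun n s =>
    (smx s).continuous_iteratedDeriv n (by exact_mod_cast le_top)
  have dit : ∀ (n : ℕ) s p, HasDerivAt (iteratedDeriv n (fun p => u p s))
      (iteratedDeriv (n + 1) (fun p => u p s) p) p := by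
    intro n s p
    rw [iteratedDeriv_succ]
    refine DifferentiableAt.hasDerivAt ?_
    exact ((smx s).differentiable_iteratedDeriv n (by exact_mod_cast WithTop.coe_lt_top _)) p
  have hut : ∀ p s, deriv (fun s => u p s) s =
      Complex.I * ε / 2 * iteratedDeriv 2 (fun x' => u x' s) p
      - Complex.I / ε * ((a * p ^ 2 + b * p + c : ℝ) : ℂ) * u p s := by
    intro p s
    have := heq p s
    generalize ((a * p ^ 2 + b * p + c : ℝ) : ℂ) = V at this ⊢
    field_simp
    linear_combination 2 * this
  have cu : ∀ s, Continuous (fun p => u p s) := fun s => (smx s).continuous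
  have cut : ∀ s, Continuous (fun p => deriv (fun s => u p s) s) := by
    intro s
    simp_rw [hut]
    have h1 := cit 2 s
    have h2 := cu s
    fun_prop
  have decu : ∀ T, ∃ C, ∀ s, |s| ≤ T → Dec C (fun p => u p s) := by
    intro T
    refine dec_unif cu fun n => ?_
    simpa using hu_schwartz n 0 T
  have decut : ∀ T, ∃ C, ∀ s, |s| ≤ T → Dec C (fun p => deriv (fun s => u p s) s) := by
    intro T
    refine dec_unif cut fun n => ?_
    simpa using hut_schwartz n 0 T
  have decit : ∀ m : ℕ, ∃ C, Dec C (iteratedDeriv m (fun p => u p t)) := by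
    intro m
    obtain ⟨C, hC⟩ := dec_unif (cit m) fun n => hu_schwartz n m |t|
    exact ⟨C, hC t le_rfl⟩
  have hS : ∀ s x k, swt ε σx σk (fun x' => u x' s) (fun x' => u x' s) x k =
      c₀ * ∫ z : ℝ × ℝ, kerK A B ε x k z.1 z.2 *
        (u z.1 s * (starRingEnd ℂ) (u z.2 s)) := by
    intro s x k
    obtain ⟨C, hC⟩ := decu |s|
    exact hswt C _ (hC s le_rfl) x k
  simp_rw [hS]
  obtain ⟨C, hC⟩ := decu (|t| + 1)
  obtain ⟨C', hC'⟩ := decut (|t| + 1)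
  have ht : |t| ≤ |t| + 1 := by linarith
  have hf : Dec C (fun p => u p t) := hC t ht
  have hg := hf.conj
  -- derivatives
  have Dt := (J_dt (ε := ε) hA0 hB0 x k t (U := fun s p => u p s) cu hC hC'
    (fun s p => (((smt p).differentiable (by simp)) s).hasDerivAt)).const_mul c₀
  have Dk := fun x => (J_dk hA0 hB0 hε x k hf hg).const_mul c₀
  have Dx : HasDerivAt (fun x => c₀ * ∫ z : ℝ × ℝ, kerK A B ε x k z.1 z.2 *
        (u z.1 t * (starRingEnd ℂ) (u z.2 t))) (c₀ * ∫ z : ℝ × ℝ,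
        ((-2 * A * (x - (z.1 + z.2) / 2)) * kerK A B ε x k z.1 z.2) *
        (u z.1 t * (starRingEnd ℂ) (u z.2 t))) x := by
    have := (J_dx (ε := ε) hA0 hB0 x k hf hg (m := fun _ => 1) (N := 1) continuous_const
      zero_le_one (fun p q => by simpa using rho_one p q)).const_mul c₀
    simpa only [one_mul] using this
  have b5 : ∀ p q : ℝ, ‖(-2 * π * Complex.I * ((p - q) / ε) : ℂ)‖ ≤
      (2 * π * ε⁻¹) * (1 + |p| + |q|) := by
    intro p q
    have h2 := lin2 hε p q
    have := Real.pi_pos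
    rw [norm_mul, norm_mul, norm_mul, Complex.norm_real, Real.norm_eq_abs,
        abs_of_pos Real.pi_pos, norm_neg, Complex.norm_ofNat, Complex.norm_I, mul_one,
        mul_assoc (2 * π)]
    gcongr
  have Dxk := (J_dx (ε := ε) hA0 hB0 x k hf hg
    (m := fun z => (-2 * π * Complex.I * ((z.1 - z.2) / ε))) (N := 2 * π * ε⁻¹) (by fun_prop)
    (by positivity) (fun p q => b5 p q)).const_mul c₀
  rw [Dt.deriv, Dx.deriv, (Dk x).deriv]
  simp_rw [fun x => (Dk x).deriv]
  rw [Dxk.deriv]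
  -- integration by parts
  obtain ⟨C1, hf1⟩ := decit 1
  obtain ⟨C2, hf2⟩ := decit 2
  have d0 : ∀ p, HasDerivAt (fun p => u p t) (iteratedDeriv 1 (fun p => u p t) p) p := by
    intro p
    have := dit 0 t p
    rwa [iteratedDeriv_zero] at this
  have P1 := ibp_p hA0 hB0 hε x k hf hf1 hf2 hg d0 (dit 1 t)
  have P2 := ibp_q hA0 hB0 hε x k hg hf1.conj hf2.conj hf (fun p => (d0 p).star)
    (fun p => (dit 1 t p).star)
  obtain ⟨M, hM0, hM⟩ := ker_bounds hA0 hB0 hε x k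
  have j1 := int_fg hf2 hg (kerK_cont A B ε x k) (fun p q => (hM p q).1)
  have j2 := int_fg hf hf2.conj (kerK_cont A B ε x k) (fun p q => (hM p q).1)
  obtain ⟨N, hN0, hN⟩ := kL_bound A B ε hε x k
  have sqb : ∀ (L : ℂ) (p q : ℝ), ‖L‖ ≤ N * (1 + |p| + |q|) →
      ‖L ^ 2 - (A / 2 + 2 * B / ε ^ 2)‖ ≤
        (N ^ 2 + ‖((A : ℂ) / 2 + 2 * B / ε ^ 2)‖) * (1 + |p| + |q|) ^ 2 := by
    intro L p q hL
    refine (norm_sub_le _ _).trans ?_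
    rw [norm_pow, add_mul, ← mul_pow]
    have h3 : 1 ≤ (1 + |p| + |q|) ^ 2 := by nlinarith [rho_one p q]
    gcongr
    exact le_mul_of_one_le_right (norm_nonneg _) h3
  have i1 := int_l (ε := ε) hA0 hB0 x k hf hg
    (fun z => kLp A B ε x k z.1 z.2 ^ 2 - (A / 2 + 2 * B / ε ^ 2))
    (((kLp_cont A B ε x k).pow 2).sub continuous_const) ⟨_, fun p q => sqb _ p q (hN p q).1⟩
  have i2 := int_l (ε := ε) hA0 hB0 x k hf hg
    (fun z => kLq A B ε x k z.1 z.2 ^ 2 - (A / 2 + 2 * B / ε ^ 2))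
    (((kLq_cont A B ε x k).pow 2).sub continuous_const) ⟨_, fun p q => sqb _ p q (hN p q).2⟩
  have i3 := int_l (ε := ε) hA0 hB0 x k hf hg
    (fun z => ((a * z.1 ^ 2 + b * z.1 + c : ℝ) : ℂ) - ((a * z.2 ^ 2 + b * z.2 + c : ℝ) : ℂ))
    (by fun_prop) ⟨_, fun p q => V_bound a b c p q⟩
  have b4 : ∀ p q : ℝ, ‖(-2 * A * (x - (p + q) / 2) : ℂ)‖ ≤
      (2 * A * (|x| + 1)) * (1 + |p| + |q|) := by
    intro p q
    have h2 := lin1 x p q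
    rw [norm_mul, norm_mul, Complex.norm_real, Real.norm_eq_abs,
        abs_of_nonneg hA0, norm_neg, Complex.norm_ofNat, mul_assoc (2 * A)]
    gcongr
  have up : ∀ {v n p q : ℝ}, 0 ≤ n → v ≤ n * (1 + |p| + |q|) → v ≤ n * (1 + |p| + |q|) ^ 2 := by
    intro v n p q hn h
    refine h.trans (mul_le_mul_of_nonneg_left ?_ hn)
    nlinarith [rho_one p q]
  have i4 := int_l (ε := ε) hA0 hB0 x k hf hg (fun z => -2 * A * (x - (z.1 + z.2) / 2))
    (by fun_prop) ⟨_, fun p q => up (by positivity) (b4 p q)⟩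
  have i5 := int_l (ε := ε) hA0 hB0 x k hf hg (fun z => -2 * π * Complex.I * ((z.1 - z.2) / ε))
    (by fun_prop) ⟨_, fun p q => up (by positivity) (b5 p q)⟩
  have i6 := int_l (ε := ε) hA0 hB0 x k hf hg
    (fun z => (-2 * π * Complex.I * ((z.1 - z.2) / ε)) * (-2 * A * (x - (z.1 + z.2) / 2)))
    (by fun_prop) ⟨(2 * π * ε⁻¹) * (2 * A * (|x| + 1)), fun p q => by
      rw [norm_mul]
      refine (mul_le_mul (b5 p q) (b4 p q) (norm_nonneg _) ?_).trans (le_of_eq (by ring))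
      positivity⟩
  have T1 : ∫ z : ℝ × ℝ, (kerK A B ε x k z.1 z.2 *
        (deriv (fun s => u z.1 s) t * (starRingEnd ℂ) (u z.2 t)) +
        kerK A B ε x k z.1 z.2 * (u z.1 t * (starRingEnd ℂ) (deriv (fun s => u z.2 s) t)))
      = Complex.I * ε / 2 * (∫ z : ℝ × ℝ, ((kLp A B ε x k z.1 z.2 ^ 2 - (A / 2 + 2 * B / ε ^ 2)) *
          kerK A B ε x k z.1 z.2) * (u z.1 t * (starRingEnd ℂ) (u z.2 t)))
        - Complex.I * ε / 2 * (∫ z : ℝ × ℝ, ((kLq A B ε x k z.1 z.2 ^ 2 - (A / 2 + 2 * B / ε ^ 2)) *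
          kerK A B ε x k z.1 z.2) * (u z.1 t * (starRingEnd ℂ) (u z.2 t)))
        - Complex.I / ε * (∫ z : ℝ × ℝ, ((((a * z.1 ^ 2 + b * z.1 + c : ℝ) : ℂ) -
          ((a * z.2 ^ 2 + b * z.2 + c : ℝ) : ℂ)) *
          kerK A B ε x k z.1 z.2) * (u z.1 t * (starRingEnd ℂ) (u z.2 t))) := by
    rw [← P1, ← P2]
    refine lin3 j1 j2 i3 _ _ _ fun z => ?_
    rw [hut, hut]
    simp only [map_sub, map_mul, map_div₀, Complex.conj_I, Complex.conj_ofReal, map_ofNat]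
    ring
  have key : Complex.I * ε / 2 * (∫ z : ℝ × ℝ,
        ((kLp A B ε x k z.1 z.2 ^ 2 - (A / 2 + 2 * B / ε ^ 2)) *
          kerK A B ε x k z.1 z.2) * (u z.1 t * (starRingEnd ℂ) (u z.2 t)))
        + (-(Complex.I * ε / 2)) * (∫ z : ℝ × ℝ,
          ((kLq A B ε x k z.1 z.2 ^ 2 - (A / 2 + 2 * B / ε ^ 2)) *
          kerK A B ε x k z.1 z.2) * (u z.1 t * (starRingEnd ℂ) (u z.2 t)))
        + (-(Complex.I / ε)) * (∫ z : ℝ × ℝ, ((((a * z.1 ^ 2 + b * z.1 + c : ℝ) : ℂ) -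
          ((a * z.2 ^ 2 + b * z.2 + c : ℝ) : ℂ)) *
          kerK A B ε x k z.1 z.2) * (u z.1 t * (starRingEnd ℂ) (u z.2 t)))
        + 2 * π * k * (∫ z : ℝ × ℝ,
        ((-2 * A * (x - (z.1 + z.2) / 2)) * kerK A B ε x k z.1 z.2) *
        (u z.1 t * (starRingEnd ℂ) (u z.2 t)))
        + (-((2 * a * x + b) / (2 * π))) * (∫ z : ℝ × ℝ,
        ((-2 * π * Complex.I * ((z.1 - z.2) / ε)) * kerK A B ε x k z.1 z.2) *
        (u z.1 t * (starRingEnd ℂ) (u z.2 t)))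
        + ε * (σk ^ 2 / 2 - 2 * a * σx ^ 2 / (8 * π ^ 2)) * (∫ z : ℝ × ℝ,
        (((-2 * π * Complex.I * ((z.1 - z.2) / ε)) * (-2 * A * (x - (z.1 + z.2) / 2))) *
          kerK A B ε x k z.1 z.2) *
        (u z.1 t * (starRingEnd ℂ) (u z.2 t))) = 0 := by
    refine lin6 i1 i2 i3 i4 i5 i6 _ _ _ _ _ _ fun z => ?_
    have hπ : (π : ℂ) ≠ 0 := by exact_mod_cast Real.pi_ne_zero
    have hσxC : (σx : ℂ) ≠ 0 := by exact_mod_cast hσx.ne'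
    have hσkC : (σk : ℂ) ≠ 0 := by exact_mod_cast hσk.ne'
    have fin : Complex.I * ε / 2 * (kLp A B ε x k z.1 z.2 ^ 2 - (A / 2 + 2 * B / ε ^ 2))
      + (-(Complex.I * ε / 2)) * (kLq A B ε x k z.1 z.2 ^ 2 - (A / 2 + 2 * B / ε ^ 2))
      + (-(Complex.I / ε)) * (((a * z.1 ^ 2 + b * z.1 + c : ℝ) : ℂ) -
          ((a * z.2 ^ 2 + b * z.2 + c : ℝ) : ℂ))
      + 2 * π * k * (-2 * A * (x - (z.1 + z.2) / 2))
      + (-((2 * a * x + b) / (2 * π))) * (-2 * π * Complex.I * ((z.1 - z.2) / ε))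
      + ε * (σk ^ 2 / 2 - 2 * a * σx ^ 2 / (8 * π ^ 2)) *
        ((-2 * π * Complex.I * ((z.1 - z.2) / ε)) * (-2 * A * (x - (z.1 + z.2) / 2))) = 0 := by
      unfold kLp kLq
      rw [hA, hB]
      push_cast
      field_simp
      ring_nf
      simp only [Complex.I_sq]
      ring
    linear_combination (kerK A B ε x k z.1 z.2 * (u z.1 t * (starRingEnd ℂ) (u z.2 t))) * fin
  rw [T1]
  simp only [← mul_assoc] at key ⊢
  linear_combination c₀ * key
end
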